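/- arXiv:1610.09888 — 4 statements merged into one kernel-verified Lean document; each statement's English description precedes it below -/
import Mathlib

section
/- Let G be a finite connected simple graph and V a subset of V(G). Then G admits an antiparallel double trace in which every nontrivial repetition occurs at a vertex of V (i.e., for every vertex v not in V, the trace has no nontrivial repetition at v) if and only if there exists a spanning tree T of G with the property that every connected component of the co-tree G - E(T) has an even number of edges or contains a vertex of V. -/
open SimpleGraph

/-- A closed walk is a *double trace* if it traverses every edge of the graph exactly twice. -/
def IsDoubleTrace {V : Type*} [DecidableEq V] {G : SimpleGraph V} {x : V} (w : G.Walk x x) : Prop :=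
  ∀ e ∈ G.edgeSet, w.edges.count e = 2

/-- The number of times a walk traverses the edge between `a` and `b`
in the direction from `a` to `b`. -/
def traversals {V : Type*} [DecidableEq V] {G : SimpleGraph V} {x y : V} (w : G.Walk x y)
    (a b : V) : ℕ :=
  (w.darts.map SimpleGraph.Dart.toProd).count (a, b)

/-- A closed walk `w` has an `N`-repetition at `v`: whenever `w` visits `v` (indices taken
cyclically), the predecessor vertex lies in `N` iff the successor vertex lies in `N`. -/
def HasRepetition {V : Type*} {G : SimpleGraph V} {x : V} (w : G.Walk x x) (v : V)
    (N : Set V) : Prop :=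
  ∀ i < w.length, w.getVert i = v →
    ((w.getVert ((i + w.length - 1) % w.length) ∈ N) ↔ (w.getVert ((i + 1) % w.length) ∈ N))

/-- A *strong trace* is a double trace without nontrivial repetitions: there is no vertex `v`
and set `N` of neighbours of `v`, nonempty and proper in `N(v)`, forming an `N`-repetition. -/
def IsStrongTrace {V : Type*} [DecidableEq V] {G : SimpleGraph V} {x : V} (w : G.Walk x x) : Prop :=
  IsDoubleTrace w ∧
    ∀ (v : V) (N : Set V), N ⊆ G.neighborSet v → N.Nonempty → N ≠ G.neighborSet v →
      ¬ HasRepetition w v N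

/-- A *`d`-stable trace* is a double trace without `N`-repetitions for sets `N` of neighbours
with `1 ≤ |N| ≤ d`. -/
def IsStableTrace {V : Type*} [DecidableEq V] {G : SimpleGraph V} (d : ℕ) {x : V}
    (w : G.Walk x x) : Prop :=
  IsDoubleTrace w ∧
    ∀ (v : V) (N : Set V), N ⊆ G.neighborSet v → 1 ≤ N.ncard → N.ncard ≤ d →
      ¬ HasRepetition w v N

/-- A closed walk is *antiparallel* if it traverses every edge once in each direction. -/
def IsAntiparallel {V : Type*} [DecidableEq V] {G : SimpleGraph V} {x : V}
    (w : G.Walk x x) : Prop :=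
  ∀ a b, G.Adj a b → traversals w a b = 1 ∧ traversals w b a = 1

/-- A closed walk is *parallel* if it traverses every edge twice in the same direction. -/
def IsParallel {V : Type*} [DecidableEq V] {G : SimpleGraph V} {x : V}
    (w : G.Walk x x) : Prop :=
  ∀ a b, G.Adj a b →
    (traversals w a b = 2 ∧ traversals w b a = 0) ∨
      (traversals w a b = 0 ∧ traversals w b a = 2)

/-- `T` is a spanning tree of `G`: a connected acyclic spanning subgraph. -/
def IsSpanningTree {V : Type*} (G T : SimpleGraph V) : Prop :=
  T ≤ G ∧ T.Connected ∧ T.IsAcyclic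

/-- The number of edges of `H` lying in the connected component `C` of `H`. -/
noncomputable def componentEdgeCount {V : Type*} (H : SimpleGraph V)
    (C : H.ConnectedComponent) : ℕ :=
  {e : Sym2 V | e ∈ H.edgeSet ∧ ∀ a ∈ e, a ∈ C.supp}.ncard





namespace ADT

variable {V : Type*}

theorem chain_single {α : Type*} (R : α → α → Prop) (X : List α) (hX : X ≠ []) :
    Cycle.Chain R (X : Cycle α) ↔ X.IsChain R ∧ R (X.getLast hX) (X.head hX) := by
  rw [Cycle.chain_ne_nil R hX, List.isChain_cons]
  obtain ⟨x, X, rfl⟩ := List.exists_cons_of_ne_nil hX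
  simp [and_comm]

theorem chain_three {α : Type*} (R : α → α → Prop) (X Y Z : List α) (hX : X ≠ []) (hY : Y ≠ [])
    (hZ : Z ≠ []) :
    Cycle.Chain R ((Z ++ (Y ++ X) : List α) : Cycle α) ↔
      X.IsChain R ∧ Y.IsChain R ∧ Z.IsChain R ∧ R (Z.getLast hZ) (Y.head hY) ∧
        R (Y.getLast hY) (X.head hX) ∧ R (X.getLast hX) (Z.head hZ) := by
  rw [chain_single R _ (by simp [hX])]
  obtain ⟨x, X, rfl⟩ := List.exists_cons_of_ne_nil hX
  obtain ⟨y, Y, rfl⟩ := List.exists_cons_of_ne_nil hY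
  obtain ⟨z, Z, rfl⟩ := List.exists_cons_of_ne_nil hZ
  rw [List.isChain_append, List.isChain_append]
  simp only [List.getLast?_eq_getLast_of_ne_nil hX, List.getLast?_eq_getLast_of_ne_nil hY,
    List.getLast?_eq_getLast_of_ne_nil hZ, List.getLast_append_of_ne_nil _ hX,
    List.getLast_append_of_ne_nil _ (List.append_ne_nil_of_right_ne_nil _ hX)]
  simp
  tauto

theorem chain_big {α : Type*} (R : α → α → Prop) (X Y Z : List α) (hX : X ≠ []) (hY : Y ≠ [])
    (hZ : Z ≠ []) (d d' f f' : α) :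
    Cycle.Chain R ((d :: f :: (X ++ d' :: (Y ++ f' :: Z)) : List α) : Cycle α) ↔
      X.IsChain R ∧ Y.IsChain R ∧ Z.IsChain R ∧ R d f ∧ R f (X.head hX) ∧ R (X.getLast hX) d' ∧
        R d' (Y.head hY) ∧ R (Y.getLast hY) f' ∧ R f' (Z.head hZ) ∧ R (Z.getLast hZ) d := by
  rw [chain_single R _ (by simp)]
  obtain ⟨x, X, rfl⟩ := List.exists_cons_of_ne_nil hX
  obtain ⟨y, Y, rfl⟩ := List.exists_cons_of_ne_nil hY
  obtain ⟨z, Z, rfl⟩ := List.exists_cons_of_ne_nil hZ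
  have e : (d :: f :: (x :: X ++ d' :: (y :: Y ++ f' :: z :: Z)))
    = [d, f] ++ ((x :: X) ++ ([d'] ++ ((y :: Y) ++ ([f'] ++ (z :: Z))))) := by simp
  simp only [e]
  repeat rw [List.isChain_append]
  simp only [List.getLast?_eq_getLast_of_ne_nil hX, List.getLast?_eq_getLast_of_ne_nil hY,
    List.getLast_append_of_ne_nil _ hZ,
    List.getLast_append_of_ne_nil _ (List.append_ne_nil_of_right_ne_nil _ hZ)]
  simp
  tauto

theorem chain_leaf {α : Type*} (R : α → α → Prop) (Y : List α) (hY : Y ≠ []) (d d' : α) :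
    Cycle.Chain R ((d :: d' :: Y : List α) : Cycle α) ↔
      Y.IsChain R ∧ R d d' ∧ R d' (Y.head hY) ∧ R (Y.getLast hY) d := by
  rw [chain_single R _ (by simp)]
  obtain ⟨y, Y, rfl⟩ := List.exists_cons_of_ne_nil hY
  simp
  tauto

structure Tr (S : Set V) (L : List (V × V)) : Prop where
  nodup : L.Nodup
  symm : ∀ p ∈ L, p.swap ∈ L
  ne : ∀ p ∈ L, p.1 ≠ p.2
  chain : Cycle.Chain (fun p q : V × V => p.2 = q.1) (L : Cycle (V × V))
  norep : ∀ χ : V × V → Prop, Cycle.Chain (fun p q : V × V => (χ p.swap ↔ χ q)) (L : Cycle (V × V)) →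
    ∀ p ∈ L, ∀ q ∈ L, p.1 = q.1 → p.1 ∉ S → (χ p ↔ χ q)

theorem Tr.nil (S : Set V) : Tr S [] := by
  constructor <;> simp

theorem Tr.rot {S : Set V} {L L' : List (V × V)} (h : Tr S L) (hr : L ~r L') : Tr S L' := by
  have e : (L : Cycle (V × V)) = L' := Cycle.coe_eq_coe.2 hr
  have hm : ∀ p, p ∈ L' ↔ p ∈ L := fun p => hr.perm.mem_iff.symm
  refine ⟨hr.perm.nodup_iff.1 h.nodup, ?_, ?_, e ▸ h.chain, ?_⟩
  · simpa only [hm] using h.symm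
  · simpa only [hm] using h.ne
  · simpa only [hm, ← e] using h.norep

/-- rotate so that a given element is first -/
theorem rot_to {α : Type*} {L : List α} {p : α} (hp : p ∈ L) : ∃ l, L ~r (p :: l) := by
  obtain ⟨A, B, rfl⟩ := List.append_of_mem hp
  exact ⟨B ++ A, by simpa using List.isRotated_append (l := A) (l' := p :: B)⟩

/-- the pair surgery, adding -/
theorem Tr.add_pair {S : Set V} {X Y Z : List (V × V)} {a u w : V}
    (hX : X ≠ []) (hY : Y ≠ []) (hZ : Z ≠ [])
    (hx : (X.head hX).1 = w) (hy : (Y.head hY).1 = a) (hz : (Z.head hZ).1 = u)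
    (hau : a ≠ u) (hwu : w ≠ u) (haw : a ≠ w)
    (ha : (a, u) ∉ Z ++ (Y ++ X)) (hw : (w, u) ∉ Z ++ (Y ++ X))
    (h : Tr S (Z ++ (Y ++ X))) :
    Tr S ((a, u) :: (u, w) :: (X ++ (u, a) :: (Y ++ (w, u) :: Z))) := by
  have ha' : (u, a) ∉ Z ++ (Y ++ X) := fun hh => ha (h.symm _ hh)
  have hw' : (u, w) ∉ Z ++ (Y ++ X) := fun hh => hw (h.symm _ hh)
  have hc := (chain_three _ X Y Z hX hY hZ).1 h.chain
  have hP : List.Perm ((a, u) :: (u, w) :: (X ++ (u, a) :: (Y ++ (w, u) :: Z)))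
      ((a, u) :: (u, w) :: (u, a) :: (w, u) :: (Z ++ (Y ++ X))) := by
    classical
    rw [List.perm_iff_count]
    intro p
    simp [List.count_cons, List.count_append]
    omega
  refine ⟨?_, ?_, ?_, ?_, ?_⟩
  · rw [hP.nodup_iff]
    have := h.nodup
    simp only [List.nodup_cons, List.mem_cons]
    simp only [Prod.mk.injEq]
    grind
  · intro p hp
    rw [hP.mem_iff] at hp ⊢
    simp only [List.mem_cons] at hp ⊢
    rcases hp with rfl | rfl | rfl | rfl | hp
    · simp
    · simp
    · simp
    · simp
    · have := h.symm p hp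
      tauto
  · intro p hp
    rw [hP.mem_iff] at hp
    simp only [List.mem_cons] at hp
    rcases hp with rfl | rfl | rfl | rfl | hp
    · exact hau
    · exact hwu.symm
    · exact hau.symm
    · exact hwu
    · exact h.ne p hp
  · rw [chain_big _ X Y Z hX hY hZ]
    grind
  · intro χ hχ
    rw [chain_big _ X Y Z hX hY hZ] at hχ
    obtain ⟨h1, h2, h3, h4, h5, h6, h7, h8, h9, h10⟩ := hχ
    simp only [Prod.swap_prod_mk] at h4 h5 h6 h7 h8 h9 h10
    have key := h.norep χ ((chain_three _ X Y Z hX hY hZ).2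
      ⟨h1, h2, h3, h10.trans h7, h8.trans h5, h6.trans (h4.trans h9)⟩)
    have hold : ∀ p ∈ (a, u) :: (u, w) :: (X ++ (u, a) :: (Y ++ (w, u) :: Z)),
        ∃ q ∈ Z ++ (Y ++ X), q.1 = p.1 ∧ (χ p ↔ χ q) := by
      intro p hp
      rw [hP.mem_iff] at hp
      simp only [List.mem_cons] at hp
      have mX := List.head_mem hX
      have mY := List.head_mem hY
      have mZ := List.head_mem hZ
      rcases hp with rfl | rfl | rfl | rfl | hp
      · exact ⟨Y.head hY, by simp, hy, h7⟩
      · exact ⟨Z.head hZ, by simp, hz, h9⟩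
      · exact ⟨Z.head hZ, by simp, hz, h4.trans h9⟩
      · exact ⟨X.head hX, by simp, hx, h5⟩
      · exact ⟨p, hp, rfl, Iff.rfl⟩
    intro p hp q hq hpq hpS
    obtain ⟨p', hp', e1, i1⟩ := hold p hp
    obtain ⟨q', hq', e2, i2⟩ := hold q hq
    exact i1.trans ((key p' hp' q' hq' (by rw [e1, e2, hpq]) (by rwa [e1])).trans i2.symm)

/-- the pair surgery, deleting -/
theorem Tr.del_pair {S : Set V} {X Y Z : List (V × V)} {a u w : V}
    (hX : X ≠ []) (hY : Y ≠ []) (hZ : Z ≠ [])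
    (h : Tr S ((a, u) :: (u, w) :: (X ++ (u, a) :: (Y ++ (w, u) :: Z)))) :
    Tr S (Z ++ (Y ++ X)) := by
  classical
  have hc := (chain_big _ X Y Z hX hY hZ _ _ _ _).1 h.chain
  have hP : List.Perm ((a, u) :: (u, w) :: (X ++ (u, a) :: (Y ++ (w, u) :: Z)))
      ((a, u) :: (u, w) :: (u, a) :: (w, u) :: (Z ++ (Y ++ X))) := by
    rw [List.perm_iff_count]
    intro p
    simp [List.count_cons, List.count_append]
    omega
  have hnd := hP.nodup_iff.1 h.nodup
  simp only [List.nodup_cons, List.mem_cons, not_or] at hnd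
  obtain ⟨⟨n11, n12, n13, n14⟩, ⟨n21, n22, n23⟩, ⟨n31, n32⟩, n41, hnd⟩ := hnd
  have up : ∀ p ∈ Z ++ (Y ++ X), p ∈ ((a, u) :: (u, w) :: (X ++ (u, a) :: (Y ++ (w, u) :: Z))) := by
    intro p hp
    rw [hP.mem_iff]
    exact List.mem_cons_of_mem _ (List.mem_cons_of_mem _ (List.mem_cons_of_mem _
      (List.mem_cons_of_mem _ hp)))
  have hsym : ∀ p ∈ Z ++ (Y ++ X), p.swap ∈ Z ++ (Y ++ X) := by
    intro p hp
    have := h.symm p (up p hp)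
    rw [hP.mem_iff] at this
    simp only [List.mem_cons] at this
    rcases this with e | e | e | e | e
    · rw [Prod.swap_eq_iff_eq_swap] at e; subst e; exact absurd hp n32
    · rw [Prod.swap_eq_iff_eq_swap] at e; subst e; exact absurd hp n41
    · rw [Prod.swap_eq_iff_eq_swap] at e; subst e; exact absurd hp n14
    · rw [Prod.swap_eq_iff_eq_swap] at e; subst e; exact absurd hp n23
    · exact e
  refine ⟨?_, hsym, ?_, ?_, ?_⟩
  · exact hnd
  · intro p hp
    exact h.ne p (up p hp)
  · rw [chain_three _ X Y Z hX hY hZ]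
    grind
  · intro χ hχ
    rw [chain_three _ X Y Z hX hY hZ] at hχ
    obtain ⟨h1, h2, h3, h4, h5, h6⟩ := hχ
    have mX := List.head_mem hX
    have mY := List.head_mem hY
    have mZ := List.head_mem hZ
    have lX := List.getLast_mem hX
    have lY := List.getLast_mem hY
    have lZ := List.getLast_mem hZ
    let χ' : V × V → Prop := fun p =>
      if p = (u, a) then χ (Z.head hZ) else if p = (u, w) then χ (Z.head hZ) else
      if p = (w, u) then χ (X.head hX) else if p = (a, u) then χ (Y.head hY) else χ p
    have old : ∀ p ∈ Z ++ (Y ++ X), (χ' p ↔ χ p) := by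
      intro p hp
      have e1 : p ≠ (u, a) := by rintro rfl; exact n32 hp
      have e2 : p ≠ (u, w) := by rintro rfl; exact n23 hp
      have e3 : p ≠ (w, u) := by rintro rfl; exact n41 hp
      have e4 : p ≠ (a, u) := by rintro rfl; exact n14 hp
      simp [χ', e1, e2, e3, e4]
    have hau : a ≠ u := h.ne (a, u) (by simp)
    have hwu : u ≠ w := h.ne (u, w) (by simp)
    have haw : a ≠ w := by
      rintro rfl
      exact n21 rfl
    have c1 : (χ' (u, a) ↔ χ (Z.head hZ)) := by simp [χ']
    have c2 : (χ' (u, w) ↔ χ (Z.head hZ)) := by simp [χ']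
    have c3 : (χ' (w, u) ↔ χ (X.head hX)) := by
      simp [χ', hwu, hwu.symm]
    have c4 : (χ' (a, u) ↔ χ (Y.head hY)) := by
      simp [χ', hau, haw]
    have im : ∀ W : List (V × V), (∀ p ∈ W, p ∈ Z ++ (Y ++ X)) →
        W.IsChain (fun p q : V × V => (χ p.swap ↔ χ q)) →
        W.IsChain (fun p q : V × V => (χ' p.swap ↔ χ' q)) := by
      intro W hW hh
      refine List.IsChain.imp_of_mem_imp ?_ hh
      intro p q hp hq hpq
      rw [old _ (hsym _ (hW _ hp)), old _ (hW _ hq)]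
      exact hpq
    have key := h.norep χ' ((chain_big _ X Y Z hX hY hZ _ _ _ _).2
      ⟨im X (by simp +contextual) h1, im Y (by simp +contextual) h2, im Z (by simp +contextual) h3,
        by simp [c1, c2],
        by rw [old (X.head hX) (by simp)]; simpa using c3,
        by rw [old _ (hsym _ (by simp)), c1]; exact h6,
        by rw [old (Y.head hY) (by simp)]; simpa using c4,
        by rw [old _ (hsym _ (by simp)), c3]; exact h5,
        by rw [old (Z.head hZ) (by simp)]; simpa using c2,
        by rw [old _ (hsym _ (by simp)), c4]; exact h4⟩)
    intro p hp q hq hpq hpS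
    have := key p (up p hp) q (up q hq) hpq hpS
    rwa [old p hp, old q hq] at this

theorem Tr.add_leaf_nil {S : Set V} {a u : V} (hau : a ≠ u) : Tr S [(a, u), (u, a)] := by
  refine ⟨by simp [hau], by simp, by simp [hau, hau.symm], ?_, ?_⟩
  · rw [Cycle.chain_coe_cons]; simp
  · intro χ _
    simp [hau, hau.symm]

theorem Tr.add_leaf {S : Set V} {Y : List (V × V)} {a u : V} (hY : Y ≠ [])
    (hy : (Y.head hY).1 = a) (hau : a ≠ u) (ha : (a, u) ∉ Y)
    (hu : u ∈ S ∨ ∀ p ∈ Y, p.1 ≠ u) (h : Tr S Y) :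
    Tr S ((a, u) :: (u, a) :: Y) := by
  have ha' : (u, a) ∉ Y := fun hh => ha (h.symm _ hh)
  have hc := (chain_single _ Y hY).1 h.chain
  have mY := List.head_mem hY
  refine ⟨?_, ?_, ?_, ?_, ?_⟩
  · have := h.nodup
    simp only [List.nodup_cons, List.mem_cons, Prod.mk.injEq]
    grind
  · intro p hp
    simp only [List.mem_cons] at hp ⊢
    rcases hp with rfl | rfl | hp
    · simp
    · simp
    · have := h.symm p hp
      tauto
  · intro p hp
    simp only [List.mem_cons] at hp
    rcases hp with rfl | rfl | hp
    · exact hau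
    · exact hau.symm
    · exact h.ne p hp
  · rw [chain_leaf _ Y hY]
    grind
  · intro χ hχ
    rw [chain_leaf _ Y hY] at hχ
    obtain ⟨h1, h2, h3, h4⟩ := hχ
    simp only [Prod.swap_prod_mk] at h2 h3 h4
    have key := h.norep χ ((chain_single _ Y hY).2 ⟨h1, h4.trans h3⟩)
    have hold : ∀ p ∈ (a, u) :: (u, a) :: Y, p = (u, a) ∨ 
        ∃ q ∈ Y, q.1 = p.1 ∧ (χ p ↔ χ q) := by
      intro p hp
      simp only [List.mem_cons] at hp
      rcases hp with rfl | rfl | hp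
      · exact Or.inr ⟨Y.head hY, by simp, hy, h3⟩
      · exact Or.inl rfl
      · exact Or.inr ⟨p, hp, rfl, Iff.rfl⟩
    intro p hp q hq hpq hpS
    rcases hold p hp with rfl | ⟨p', hp', e1, i1⟩
    · rcases hold q hq with rfl | ⟨q', hq', e2, i2⟩
      · rfl
      · rcases hu with hu | hu
        · exact absurd hu hpS
        · exact absurd (e2.trans hpq.symm) (hu q' hq')
    · rcases hold q hq with rfl | ⟨q', hq', e2, i2⟩
      · rcases hu with hu | hu
        · exact absurd hu (by rw [hpq] at hpS; exact hpS)
        · exact absurd (e1.trans hpq) (hu p' hp')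
      · exact i1.trans ((key p' hp' q' hq' (by rw [e1, e2, hpq]) (by rwa [e1])).trans i2.symm)

/-- at a vertex outside `S` an immediate backtrack forces a leaf -/
theorem Tr.leaf_of {S : Set V} {Y : List (V × V)} {a u : V}
    (h : Tr S ((a, u) :: (u, a) :: Y)) (hu : u ∉ S) : ∀ p ∈ Y, p.1 ≠ u := by
  intro p hp hpu
  have hau : a ≠ u := h.ne (a, u) (by simp)
  have hnd := h.nodup
  simp only [List.nodup_cons, List.mem_cons, not_or] at hnd
  have hsym : ∀ p ∈ Y, p.swap ≠ (u, a) := by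
    intro q hq e
    rw [Prod.swap_eq_iff_eq_swap] at e
    subst e
    exact hnd.1.2 hq
  have hY : Y ≠ [] := List.ne_nil_of_mem hp
  have := h.norep (fun q => q = (u, a)) ((chain_leaf _ Y hY _ _).2 ⟨?_, ?_, ?_, ?_⟩) (u, a) (by simp) p
    (by simp [hp]) hpu.symm hu
  · have e : p = (u, a) := by tauto
    subst e
    exact hnd.2.1 hp
  · refine List.IsChain.imp_of_mem_imp (R := fun _ _ => True) ?_ ?_
    · intro x y hx hy _
      have := hsym x hx
      have : y ≠ (u, a) := by rintro rfl; exact hnd.2.1 hy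
      tauto
    · exact List.Pairwise.isChain (List.pairwise_of_forall (by simp))
  · simp
  · have : Y.head hY ≠ (u, a) := fun e => hnd.2.1 (e ▸ List.head_mem hY)
    simp [this, hau]
  · have := hsym _ (List.getLast_mem hY)
    simp [this, hau]

theorem Tr.del_leaf {S : Set V} {Y : List (V × V)} {a u : V}
    (h : Tr S ((a, u) :: (u, a) :: Y)) : Tr S Y := by
  classical
  by_cases hY : Y = []
  · subst hY; exact Tr.nil S
  have hc := (chain_leaf _ Y hY _ _).1 h.chain
  have hau : a ≠ u := h.ne (a, u) (by simp)
  have hnd := h.nodup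
  simp only [List.nodup_cons, List.mem_cons, not_or] at hnd
  have hsym : ∀ p ∈ Y, p.swap ∈ Y := by
    intro p hp
    have := h.symm p (by simp only [List.mem_cons]; tauto)
    simp only [List.mem_cons] at this
    rcases this with e | e | e
    · rw [Prod.swap_eq_iff_eq_swap] at e; subst e; simp at hp hnd; tauto
    · rw [Prod.swap_eq_iff_eq_swap] at e; subst e; simp at hp hnd; tauto
    · exact e
  refine ⟨?_, hsym, ?_, ?_, ?_⟩
  · tauto
  · intro p hp
    apply h.ne
    simp only [List.mem_cons]; tauto
  · rw [chain_single _ Y hY]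
    grind
  · intro χ hχ
    rw [chain_single _ Y hY] at hχ
    obtain ⟨h1, h2⟩ := hχ
    have mY := List.head_mem hY
    have lY := List.getLast_mem hY
    let χ' : V × V → Prop := fun p => if p = (a, u) then χ (Y.head hY) else χ p
    have old : ∀ p ∈ Y, (χ' p ↔ χ p) := by
      intro p hp
      have e4 : p ≠ (a, u) := by rintro rfl; tauto
      simp [χ', e4]
    have c4 : (χ' (a, u) ↔ χ (Y.head hY)) := by
      simp [χ']
    have im : 
        Y.IsChain (fun p q : V × V => (χ' p.swap ↔ χ' q)) := by
      refine List.IsChain.imp_of_mem_imp ?_ h1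
      intro p q hp hq hpq
      rw [old _ (hsym _ hp), old _ hq]
      exact hpq
    have key := h.norep χ' ((chain_leaf _ Y hY _ _).2
      ⟨im, by simp,
        by rw [old (Y.head hY) (by simp)]; simpa using c4,
        by rw [old _ (hsym _ (by simp)), c4]; exact h2⟩)
    intro p hp q hq hpq hpS
    have := key p (by simp only [List.mem_cons]; tauto) q
      (by simp only [List.mem_cons]; tauto) hpq hpS
    rwa [old p hp, old q hq] at this

/-- reachability along a trace -/
theorem chain_reach {F : SimpleGraph V} : ∀ (l : List (V × V)) (p : V × V),
    (p :: l).IsChain (fun p q : V × V => p.2 = q.1) → (∀ q ∈ p :: l, F.Reachable q.1 q.2) →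
    ∀ q ∈ p :: l, F.Reachable p.1 q.1 := by
  intro l
  induction l with
  | nil => intro p _ _ q hq; simp at hq; subst hq; exact Reachable.refl _
  | cons r l ih =>
    intro p hc hF q hq
    rw [List.isChain_cons_cons] at hc
    rcases List.mem_cons.1 hq with rfl | hq
    · exact Reachable.refl _
    · have h1 := ih r hc.2 (fun q hq => hF q (List.mem_cons_of_mem _ hq)) q hq
      have h2 := hF p (by simp)
      rw [hc.1] at h2
      exact h2.trans h1

theorem Tr.reach {S : Set V} {L : List (V × V)} (h : Tr S L) {F : SimpleGraph V}
    (hF : ∀ p ∈ L, F.Reachable p.1 p.2) : ∀ p ∈ L, ∀ q ∈ L, F.Reachable p.1 q.1 := by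
  intro p hp q hq
  obtain ⟨l, hl⟩ := rot_to hp
  have h' := h.rot hl
  have hc := ((chain_single _ _ (by simp)).1 h'.chain).1
  refine chain_reach l p hc (fun r hr => hF r (hl.perm.mem_iff.2 hr)) q (hl.perm.mem_iff.1 hq)

/-- number of oriented edges pointing at `v` -/
def indeg [DecidableEq V] (O : Finset (V × V)) (v : V) : ℕ := (O.filter (fun p => p.2 = v)).card

theorem indeg_insert [DecidableEq V] (O : Finset (V × V)) (p : V × V) (hp : p ∉ O) (v : V) :
    indeg (insert p O) v = indeg O v + if p.2 = v then 1 else 0 := by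
  unfold indeg
  rw [Finset.filter_insert]
  split_ifs with h
  · rw [Finset.card_insert_of_notMem (by simp [hp])]
  · rfl

/-- a trace with an edge is, up to rotation, of one of two shapes -/
theorem Tr.shape {S : Set V} {L : List (V × V)} (h : Tr S L) (hL : L ≠ []) :
    (∃ a u Y, L ~r ((a, u) :: (u, a) :: Y)) ∨
    (∃ a u w X Y Z, X ≠ [] ∧ Y ≠ [] ∧ Z ≠ [] ∧
      L ~r ((a, u) :: (u, w) :: (X ++ (u, a) :: (Y ++ (w, u) :: Z)))) := by
  classical
  have hex : ∃ n, ∃ d M Q, L ~r (d :: (M ++ d.swap :: Q)) ∧ M.length = n := by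
    obtain ⟨d, l, rfl⟩ := List.exists_cons_of_ne_nil hL
    have h1 := h.symm d (by simp)
    rcases List.mem_cons.1 h1 with h1 | h1
    · exact absurd (congrArg Prod.fst h1).symm (h.ne d (by simp))
    · obtain ⟨M, Q, rfl⟩ := List.append_of_mem h1
      exact ⟨_, d, M, Q, List.IsRotated.refl _, rfl⟩
  obtain ⟨⟨a, u⟩, M, Q, hr, hn⟩ := Nat.find_spec hex
  have hmin : ∀ d' M' Q', L ~r (d' :: (M' ++ d'.swap :: Q')) → M.length ≤ M'.length := by
    intro d' M' Q' hh
    rw [hn]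
    exact Nat.find_min' hex ⟨d', M', Q', hh, rfl⟩
  simp only [Prod.swap_prod_mk] at hr
  have h' := h.rot hr
  cases M with
  | nil => exact Or.inl ⟨a, u, Q, hr⟩
  | cons f X =>
    right
    obtain ⟨u', w⟩ := f
    have hc := ((chain_single _ _ (by simp)).1 h'.chain)
    have e : u = u' := by
      have := hc.1
      simp only [List.cons_append, List.isChain_cons_cons] at this
      exact this.1
    subst e
    have hnd := h'.nodup
    have hfm := h'.symm (u, w) (by simp)
    have hau : a ≠ u := h'.ne (a, u) (by simp)
    have huw : u ≠ w := h'.ne (u, w) (by simp)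
    have haw : a ≠ w := by
      rintro rfl
      simp at hnd
    have hfX : (w, u) ∉ X := by
      intro hm
      obtain ⟨X1, X2, rfl⟩ := List.append_of_mem hm
      have := hmin (u, w) X1 (X2 ++ (u, a) :: (Q ++ [(a, u)])) (hr.trans ⟨1, by simp⟩)
      simp at this
    have hfQ : (w, u) ∈ Q := by
      simp at hfm
      rcases hfm with h1 | h1 | h1 | h1 | h1
      · exact absurd h1.symm haw
      · exact absurd h1.2 huw
      · exact absurd h1 hfX
      · exact absurd h1.2 hau.symm
      · exact h1
    obtain ⟨Y, Z, rfl⟩ := List.append_of_mem hfQ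
    refine ⟨a, u, w, X, Y, Z, ?_, ?_, ?_, by simpa using hr⟩
    · rintro rfl
      have := hc.1
      simp at this
      exact huw this.1.symm
    · rintro rfl
      have := hc.1
      simp at this
      exact haw this.2.1
    · rintro rfl
      have := hc.2
      simp at this
      exact hau this.symm

theorem aux_or (A B C D E O1 O2 : Prop) : (A ∨ B ∨ C ∨ D ∨ E ∨ O1 ∨ O2) ↔
    (E ∨ (A ∨ D ∨ O1) ∨ (C ∨ B ∨ O2)) := by
  grind

set_option maxHeartbeats 1000000 in
theorem Tr.forward [DecidableEq V] {S : Set V} : ∀ (n : ℕ) (L : List (V × V)), L.length = n → Tr S L →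
    ∃ (F : SimpleGraph V) (O : Finset (V × V)), F.IsAcyclic ∧ (∀ p ∈ O, p.swap ∉ O) ∧
      (∀ p ∈ O, ¬ F.Adj p.1 p.2) ∧ (∀ a b, (a, b) ∈ L ↔ F.Adj a b ∨ (a, b) ∈ O ∨ (b, a) ∈ O) ∧
      (∀ p ∈ L, F.Reachable p.1 p.2) ∧ ∀ v ∉ S, Even (indeg O v) := by
  intro n
  induction n using Nat.strong_induction_on with
  | _ n ih =>
  intro L hn h
  by_cases hL : L = []
  · subst hL
    refine ⟨⊥, ∅, by simp, by simp, by simp, by simp, by simp, by simp [indeg]⟩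
  rcases h.shape hL with ⟨a, u, Y, hr⟩ | ⟨a, u, w, X, Y, Z, hX, hY, hZ, hr⟩
  · have h' := h.rot hr
    have hm : ∀ p, p ∈ L ↔ p = (a, u) ∨ p = (u, a) ∨ p ∈ Y := by
      intro p; rw [hr.perm.mem_iff]; simp
    have hnd := h'.nodup
    simp only [List.nodup_cons, List.mem_cons, not_or] at hnd
    have hau : a ≠ u := h'.ne (a, u) (by simp)
    have hlen : Y.length < n := by
      have := hr.perm.length_eq
      simp at this
      omega
    obtain ⟨F, O, h1, h2, h3, h4, h5, h6⟩ := ih _ hlen Y rfl h'.del_leaf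
    have n1 : (a, u) ∉ O := fun hh => hnd.1.2 ((h4 _ _).2 (Or.inr (Or.inl hh)))
    have n2 : (u, a) ∉ O := fun hh => hnd.2.1 ((h4 _ _).2 (Or.inr (Or.inl hh)))
    have n3 : ¬ F.Adj a u := fun hh => hnd.1.2 ((h4 _ _).2 (Or.inl hh))
    by_cases hreach : F.Reachable a u
    · have huS : u ∈ S := by
        by_contra huS
        have hl := h'.leaf_of huS
        obtain ⟨p⟩ := hreach.symm
        cases p with
        | nil => exact hau rfl
        | cons e p => exact hl _ ((h4 _ _).2 (Or.inl e)) rfl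
      refine ⟨F, insert (a, u) O, h1, ?_, ?_, ?_, ?_, ?_⟩
      · intro p hp
        simp only [Finset.mem_insert] at hp ⊢
        rcases hp with rfl | hp
        · simp [n2, hau]
        · have := h2 p hp
          rintro (e | e)
          · rw [Prod.swap_eq_iff_eq_swap] at e; subst e; exact n2 hp
          · exact this e
      · intro p hp
        simp only [Finset.mem_insert] at hp
        rcases hp with rfl | hp
        · exact n3
        · exact h3 p hp
      · intro x y
        rw [hm, h4]
        simp only [Finset.mem_insert, Prod.mk.injEq]
        tauto
      · intro p hp
        rcases (hm p).1 hp with rfl | rfl | hp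
        · exact hreach
        · exact hreach.symm
        · exact h5 p hp
      · intro v hv
        rw [indeg_insert _ _ n1, if_neg (by rintro rfl; exact hv huS)]
        exact h6 v hv
    · have hadj : ∀ x y, (F ⊔ SimpleGraph.edge a u).Adj x y ↔
          F.Adj x y ∨ (x = a ∧ y = u ∨ x = u ∧ y = a) := by
        intro x y
        rw [SimpleGraph.sup_adj, SimpleGraph.edge_adj]
        constructor
        · tauto
        · rintro (h | h)
          · exact Or.inl h
          · refine Or.inr ⟨h, ?_⟩
            rintro rfl
            rcases h with h | h
            · exact hau (h.1.symm.trans h.2)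
            · exact hau (h.2.symm.trans h.1)
      refine ⟨F ⊔ SimpleGraph.edge a u, O, h1.sup_edge_of_not_reachable hreach, h2, ?_, ?_, ?_, h6⟩
      · intro p hp
        rw [hadj]
        rintro (hh | ⟨e1, e2⟩ | ⟨e1, e2⟩)
        · exact h3 p hp hh
        · exact n1 (by rw [← e1, ← e2]; exact hp)
        · exact n2 (by rw [← e1, ← e2]; exact hp)
      · intro x y
        rw [hm, h4, hadj]
        simp only [Prod.mk.injEq]
        tauto
      · intro p hp
        rcases (hm p).1 hp with rfl | rfl | hp
        · exact ((hadj _ _).2 (by simp)).reachable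
        · exact ((hadj _ _).2 (by simp)).reachable
        · exact (h5 p hp).mono le_sup_left
  · have h' := h.rot hr
    have hP : List.Perm L ((a, u) :: (u, w) :: (u, a) :: (w, u) :: (Z ++ (Y ++ X))) := by
      refine hr.perm.trans ?_
      rw [List.perm_iff_count]
      intro p
      simp [List.count_cons, List.count_append]
      omega
    have hm : ∀ p, p ∈ L ↔ p = (a, u) ∨ p = (u, w) ∨ p = (u, a) ∨ p = (w, u) ∨
        p ∈ Z ++ (Y ++ X) := by
      intro p; rw [hP.mem_iff]; simp only [List.mem_cons]
    have hnd := hP.nodup_iff.1 h.nodup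
    simp only [List.nodup_cons, List.mem_cons, not_or] at hnd
    obtain ⟨⟨n11, n12, n13, n14⟩, ⟨n21, n22, n23⟩, ⟨n31, n32⟩, n41, hnd⟩ := hnd
    have hau : a ≠ u := h'.ne (a, u) (by simp)
    have huw : u ≠ w := h'.ne (u, w) (by simp)
    have haw : a ≠ w := by rintro rfl; exact n21 rfl
    have hlen : (Z ++ (Y ++ X)).length < n := by
      have := hP.length_eq
      simp only [List.length_cons] at this
      omega
    have hd := h'.del_pair hX hY hZ
    have hc := (chain_three _ X Y Z hX hY hZ).1 hd.chain
    have hb := (chain_big _ X Y Z hX hY hZ _ _ _ _).1 h'.chain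
    obtain ⟨F, O, h1, h2, h3, h4, h5, h6⟩ := ih _ hlen _ rfl hd
    have ex : (X.head hX).1 = w := hb.2.2.2.2.1.symm
    have ey : (Y.head hY).1 = a := hb.2.2.2.2.2.2.1.symm
    have ez : (Z.head hZ).1 = u := hb.2.2.2.2.2.2.2.2.1.symm
    have hre := hd.reach h5
    have rua : F.Reachable u a := by
      have := hre (Z.head hZ) (by simp) (Y.head hY) (by simp)
      rwa [ey, ez] at this
    have ruw : F.Reachable u w := by
      have := hre (Z.head hZ) (by simp) (X.head hX) (by simp)
      rwa [ex, ez] at this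
    have up : ∀ x y, (x, y) ∉ Z ++ (Y ++ X) → (x, y) ∉ O ∧ (y, x) ∉ O ∧ ¬ F.Adj x y := by
      intro x y hxy
      rw [h4] at hxy
      tauto
    obtain ⟨o1, o2, o3⟩ := up _ _ n14
    obtain ⟨o4, o5, o6⟩ := up _ _ n41
    have o7 : (a, u) ∉ insert (w, u) O := by simp [o1, haw]
    refine ⟨F, insert (a, u) (insert (w, u) O), h1, ?_, ?_, ?_, ?_, ?_⟩
    · intro p hp
      simp only [Finset.mem_insert] at hp ⊢
      rcases hp with rfl | rfl | hp
      · simp [hau, o2]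
      · simp [huw.symm, o5]
      · rintro (e | e | e)
        · rw [Prod.swap_eq_iff_eq_swap] at e; subst e; exact o2 hp
        · rw [Prod.swap_eq_iff_eq_swap] at e; subst e; exact o5 hp
        · exact h2 p hp e
    · intro p hp
      simp only [Finset.mem_insert] at hp
      rcases hp with rfl | rfl | hp
      · exact o3
      · exact o6
      · exact h3 p hp
    · intro x y
      rw [hm, h4]
      simp only [Finset.mem_insert, Prod.mk.injEq]
      rw [and_comm (a := y = a), and_comm (a := y = w)]
      exact aux_or _ _ _ _ _ _ _
    · intro p hp
      rcases (hm p).1 hp with rfl | rfl | rfl | rfl | hp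
      · exact rua.symm
      · exact ruw
      · exact rua
      · exact ruw.symm
      · exact h5 p hp
    · intro v hv
      rw [indeg_insert _ _ o7, indeg_insert _ _ o4]
      have := h6 v hv
      simp only
      split_ifs
      · rw [add_assoc]; exact this.add (by decide)
      · simpa using this

theorem Tr.add_one {S : Set V} {L : List (V × V)} (h : Tr S L) {a u : V} (hau : a ≠ u)
    (ha : (a, u) ∉ L) (hs : L = [] ∨ ∃ p ∈ L, p.1 = a) (hu : u ∈ S ∨ ∀ p ∈ L, p.1 ≠ u) :
    ∃ L', Tr S L' ∧ L'.length = L.length + 2 ∧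
      ∀ p, p ∈ L' ↔ p = (a, u) ∨ p = (u, a) ∨ p ∈ L := by
  rcases hs with rfl | ⟨p, hp, rfl⟩
  · exact ⟨_, Tr.add_leaf_nil hau, by simp, by simp⟩
  · obtain ⟨l, hl⟩ := rot_to hp
    have hm : ∀ q, q ∈ p :: l ↔ q ∈ L := fun q => hl.perm.mem_iff.symm
    refine ⟨(p.1, u) :: (u, p.1) :: p :: l, Tr.add_leaf (by simp) (by simp) hau ?_ ?_ (h.rot hl), ?_, ?_⟩
    · rwa [hm]
    · simpa only [hm] using hu
    · have := hl.perm.length_eq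
      simp at this ⊢
      omega
    · intro q
      rw [← hm]
      simp

theorem Tr.add_two {S : Set V} {L : List (V × V)} (h : Tr S L) {a u w : V} (hau : a ≠ u)
    (hwu : w ≠ u) (haw : a ≠ w) (ha : (a, u) ∉ L) (hw : (w, u) ∉ L)
    (sa : ∃ p ∈ L, p.1 = a) (su : ∃ p ∈ L, p.1 = u) (sw : ∃ p ∈ L, p.1 = w) :
    ∃ L', Tr S L' ∧
      ∀ p, p ∈ L' ↔ p = (a, u) ∨ p = (u, a) ∨ p = (w, u) ∨ p = (u, w) ∨ p ∈ L := by
  obtain ⟨z, hz, rfl⟩ := su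
  obtain ⟨l, hl⟩ := rot_to hz
  have h' := h.rot hl
  have hm : ∀ q, q ∈ L ↔ q ∈ z :: l := fun q => hl.perm.mem_iff
  obtain ⟨y, hy, rfl⟩ := sa
  obtain ⟨x, hx, rfl⟩ := sw
  rw [hm] at hy hx
  have hy' : y ∈ l := by
    rcases List.mem_cons.1 hy with rfl | hy
    · exact absurd rfl hau
    · exact hy
  have hx' : x ∈ l := by
    rcases List.mem_cons.1 hx with rfl | hx
    · exact absurd rfl hwu
    · exact hx
  have hxy : x ≠ y := by rintro rfl; exact haw rfl
  obtain ⟨A, B, rfl⟩ := List.append_of_mem hy'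
  rw [List.mem_append, List.mem_cons] at hx'
  rcases hx' with hx' | hx' | hx'
  · obtain ⟨A, C, rfl⟩ := List.append_of_mem hx'
    have e : (z :: (A ++ x :: C ++ y :: B)) = (z :: A) ++ ((x :: C) ++ (y :: B)) := by simp
    rw [e] at h' hm
    refine ⟨_, Tr.add_pair (X := y :: B) (Y := x :: C) (Z := z :: A) (a := x.1) (u := z.1) (w := y.1)
      (by simp) (by simp) (by simp) rfl rfl rfl hwu hau haw.symm ?_ ?_ h', ?_⟩
    · rwa [← hm]
    · rwa [← hm]
    · intro q
      rw [hm]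
      simp only [List.mem_append, List.mem_cons]
      grind
  · exact absurd hx' hxy
  · obtain ⟨C, B, rfl⟩ := List.append_of_mem hx'
    have e : (z :: (A ++ y :: (C ++ x :: B))) = (z :: A) ++ ((y :: C) ++ (x :: B)) := by simp
    rw [e] at h' hm
    refine ⟨_, Tr.add_pair (X := x :: B) (Y := y :: C) (Z := z :: A) (a := y.1) (u := z.1) (w := x.1)
      (by simp) (by simp) (by simp) rfl rfl rfl hau hwu haw ?_ ?_ h', ?_⟩
    · rwa [← hm]
    · rwa [← hm]
    · intro q
      rw [hm]
      simp only [List.mem_append, List.mem_cons]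
      grind

/-- adding all oriented co-tree edges -/
theorem Tr.backward [DecidableEq V] {S : Set V} : ∀ (n : ℕ) (O : Finset (V × V)), O.card = n →
    ∀ L : List (V × V), Tr S L → (∀ v, ∃ p ∈ L, p.1 = v) → (∀ p ∈ O, p.1 ≠ p.2) →
    (∀ p ∈ O, p.swap ∉ O) → (∀ p ∈ O, p ∉ L) → (∀ v ∉ S, Even (indeg O v)) →
    ∃ L', Tr S L' ∧ ∀ p, p ∈ L' ↔ p ∈ L ∨ p ∈ O ∨ p.swap ∈ O := by
  intro n
  induction n using Nat.strong_induction_on with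
  | _ n ih =>
  intro O hn L h hs hne hsw hd hev
  rcases O.eq_empty_or_nonempty with rfl | ⟨⟨a, u⟩, hau⟩
  · exact ⟨L, h, by simp⟩
  have nau := hne _ hau
  have dau := hd _ hau
  have sau := hsw _ hau
  simp only [Prod.swap_prod_mk] at nau sau
  have hO : O = insert (a, u) (O.erase (a, u)) := (Finset.insert_erase hau).symm
  have hc1 := Finset.card_erase_of_mem hau
  have hpos := Finset.card_pos.2 ⟨_, hau⟩
  by_cases huS : u ∈ S
  · obtain ⟨L1, h1, -, m1⟩ := h.add_one nau dau (Or.inr (hs a)) (Or.inl huS)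
    refine Exists.elim (ih (O.erase (a, u)).card (by omega) (O.erase (a, u)) rfl L1 h1 ?_ ?_ ?_ ?_ ?_) ?_
    rotate_left 5
    · rintro L' ⟨h', m'⟩
      refine ⟨L', h', ?_⟩
      rintro ⟨x, y⟩
      rw [m', m1]
      simp only [Finset.mem_erase, Prod.swap_prod_mk, ne_eq, Prod.mk.injEq]
      grind
    · intro v
      obtain ⟨p, hp, e⟩ := hs v
      exact ⟨p, (m1 p).2 (Or.inr (Or.inr hp)), e⟩
    · intro p hp
      exact hne p (Finset.mem_of_mem_erase hp)
    · intro p hp hq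
      exact hsw p (Finset.mem_of_mem_erase hp) (Finset.mem_of_mem_erase hq)
    · intro p hp
      rw [m1]
      have hpO := Finset.mem_of_mem_erase hp
      rintro (rfl | rfl | hq)
      · simp at hp
      · exact sau hpO
      · exact hd p hpO hq
    · intro v hv
      have := hev v hv
      rw [hO, indeg_insert _ _ (by simp), if_neg (by rintro rfl; exact hv huS)] at this
      exact this
  · -- a second edge at u
    have he := hev u huS
    obtain ⟨⟨w, u'⟩, hwu⟩ : (O.erase (a, u) |>.filter (fun p => p.2 = u)).Nonempty := by
      rw [hO, indeg_insert _ _ (by simp), if_pos rfl] at he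
      rw [← Finset.card_pos]
      by_contra hcon
      unfold indeg at he
      rw [Nat.eq_zero_of_not_pos hcon] at he
      simp at he
    simp only [Finset.mem_filter] at hwu
    obtain ⟨hwu1, rfl⟩ := hwu
    have hwu := Finset.mem_of_mem_erase hwu1
    have nwu := hne _ hwu
    have dwu := hd _ hwu
    have swu := hsw _ hwu
    simp only [Prod.swap_prod_mk] at nwu swu
    have haw : a ≠ w := by
      rintro rfl
      simp at hwu1
    have hO' : O = insert (a, u') (insert (w, u') ((O.erase (a, u')).erase (w, u'))) := by
      rw [Finset.insert_erase hwu1]; exact hO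
    have hc2 := Finset.card_erase_of_mem hwu1
    obtain ⟨L1, h1, m1⟩ := h.add_two nau nwu haw dau dwu (hs a) (hs u') (hs w)
    refine Exists.elim (ih ((O.erase (a, u')).erase (w, u')).card (by omega) _ rfl L1 h1 ?_ ?_ ?_ ?_ ?_) ?_
    rotate_left 5
    · rintro L' ⟨h', m'⟩
      refine ⟨L', h', ?_⟩
      rintro ⟨x, y⟩
      rw [m', m1]
      simp only [Finset.mem_erase, Prod.swap_prod_mk, ne_eq, Prod.mk.injEq]
      grind
    · intro v
      obtain ⟨p, hp, e⟩ := hs v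
      exact ⟨p, (m1 p).2 (by simp [hp]), e⟩
    · intro p hp
      exact hne p (Finset.mem_of_mem_erase (Finset.mem_of_mem_erase hp))
    · intro p hp hq
      exact hsw p (Finset.mem_of_mem_erase (Finset.mem_of_mem_erase hp))
        (Finset.mem_of_mem_erase (Finset.mem_of_mem_erase hq))
    · intro p hp
      rw [m1]
      have hpO := Finset.mem_of_mem_erase (Finset.mem_of_mem_erase hp)
      rintro (rfl | rfl | rfl | rfl | hq)
      · simp at hp
      · exact sau hpO
      · simp at hp
      · exact swu hpO
      · exact hd p hpO hq
    · intro v hv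
      have := hev v hv
      rw [hO', indeg_insert _ _ (by simp [haw]), indeg_insert _ _ (by simp)] at this
      simp only at this
      split_ifs at this
      · rw [add_assoc, Nat.even_add] at this
        exact this.2 (by decide)
      · simpa using this

theorem tree_step {S : Set V} {T : SimpleGraph V} (hT : T.Connected) (hA : T.IsAcyclic)
    {L : List (V × V)} (h : Tr S L) (hL : ∀ p ∈ L, T.Adj p.1 p.2)
    (hex : ∃ x y, T.Adj x y ∧ (x, y) ∉ L) :
    ∃ L', Tr S L' ∧ L'.length = L.length + 2 ∧ ∀ p ∈ L', T.Adj p.1 p.2 := by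
  obtain ⟨x, y, hxy, hn⟩ := hex
  have hb : ∃ a u, T.Adj a u ∧ (a, u) ∉ L ∧ (L = [] ∨ ∃ p ∈ L, p.1 = a) := by
    by_cases hLn : L = []
    · exact ⟨x, y, hxy, hn, Or.inl hLn⟩
    · by_contra hcon
      push Not at hcon
      obtain ⟨p, hp⟩ := List.exists_mem_of_ne_nil L hLn
      have key : ∀ (s t : V), T.Walk s t → (∃ p ∈ L, p.1 = s) → ∃ p ∈ L, p.1 = t := by
        intro s t W
        induction W with
        | nil => exact id
        | cons e W ih =>
          rintro ⟨q, hq, e1⟩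
          apply ih
          by_contra hno
          push Not at hno
          refine (hcon _ _ e ?_).2 q hq e1
          intro hm
          exact hno _ (h.symm _ hm) rfl
      obtain ⟨W⟩ := hT.preconnected p.1 x
      obtain ⟨q, hq, e⟩ := key _ _ W ⟨p, hp, rfl⟩
      exact (hcon x y hxy hn).2 q hq e
  obtain ⟨a, u, hau, hn', hs⟩ := hb
  have hu : ∀ p ∈ L, p.1 ≠ u := by
    rintro p hp rfl
    rcases hs with rfl | ⟨q, hq, rfl⟩
    · simp at hp
    · have hbr := isAcyclic_iff_forall_adj_isBridge.1 hA hau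
      rw [isBridge_iff] at hbr
      refine hbr ?_
      refine h.reach ?_ q hq p hp
      intro r hr
      refine Adj.reachable ?_
      rw [deleteEdges_adj]
      refine ⟨hL r hr, ?_⟩
      simp only [Set.mem_singleton_iff, Sym2.eq_iff]
      rintro (⟨e1, e2⟩ | ⟨e1, e2⟩)
      · exact hn' (by rw [← e1, ← e2]; exact hr)
      · exact hn' (by rw [← e1, ← e2]; exact h.symm _ hr)
  obtain ⟨L', h', hl, hm⟩ := h.add_one hau.ne hn' hs (Or.inr hu)
  refine ⟨L', h', hl, ?_⟩
  intro p hp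
  rcases (hm p).1 hp with rfl | rfl | hp
  · exact hau
  · exact hau.symm
  · exact hL p hp

theorem tree_trace [Fintype V] {S : Set V} {T : SimpleGraph V} (hT : T.Connected)
    (hA : T.IsAcyclic) : ∃ L, Tr S L ∧ ∀ a b, (a, b) ∈ L ↔ T.Adj a b := by
  classical
  have key : ∀ n : ℕ, ∃ L, Tr S L ∧ (∀ p ∈ L, T.Adj p.1 p.2) ∧
      (n ≤ L.length ∨ ∀ a b, T.Adj a b → (a, b) ∈ L) := by
    intro n
    induction n with
    | zero => exact ⟨[], Tr.nil S, by simp, by simp⟩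
    | succ n ih =>
      obtain ⟨L, h, hL, hh⟩ := ih
      by_cases hc : ∀ a b, T.Adj a b → (a, b) ∈ L
      · exact ⟨L, h, hL, Or.inr hc⟩
      · push Not at hc
        obtain ⟨L', h', hl, hL'⟩ := tree_step hT hA h hL hc
        refine ⟨L', h', hL', Or.inl ?_⟩
        rcases hh with hh | hh
        · omega
        · obtain ⟨a, b, h1, h2⟩ := hc
          exact absurd (hh a b h1) h2
  obtain ⟨L, h, hL, hh⟩ := key (Fintype.card (V × V) + 1)
  rcases hh with hh | hh
  · have := h.nodup.length_le_card
    omega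
  · exact ⟨L, h, fun a b => ⟨hL _, hh a b⟩⟩

structure Orient (H : SimpleGraph V) (O : Finset (V × V)) : Prop where
  adj : ∀ a b, H.Adj a b ↔ (a, b) ∈ O ∨ (b, a) ∈ O
  asym : ∀ p ∈ O, p.swap ∉ O

theorem Orient.count [Fintype V] [DecidableEq V] {H : SimpleGraph V} {O : Finset (V × V)}
    (h : Orient H O) (C : H.ConnectedComponent) :
    componentEdgeCount H C = ∑ v ∈ (Set.toFinite C.supp).toFinset, indeg O v := by
  classical
  unfold componentEdgeCount
  have hset : {e : Sym2 V | e ∈ H.edgeSet ∧ ∀ a ∈ e, a ∈ C.supp} =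
      ((O.filter (fun p => p.2 ∈ C.supp)).image (fun p => s(p.1, p.2)) : Finset (Sym2 V)) := by
    ext e
    induction e with
    | _ a b =>
    simp only [Set.mem_ofPred_eq, mem_edgeSet, Sym2.mem_iff, Finset.coe_image, Finset.coe_filter,
      Set.mem_image, Prod.exists, Sym2.eq_iff]
    constructor
    · rintro ⟨hab, hc⟩
      rcases (h.adj a b).1 hab with hh | hh
      · exact ⟨a, b, ⟨hh, hc b (Or.inr rfl)⟩, by simp⟩
      · exact ⟨b, a, ⟨hh, hc a (Or.inl rfl)⟩, by simp⟩
    · rintro ⟨x, y, ⟨hO, hy⟩, hxy⟩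
      have hadj : H.Adj x y := (h.adj x y).2 (Or.inl hO)
      have hx : x ∈ C.supp := by
        rw [ConnectedComponent.mem_supp_iff] at hy ⊢
        rw [← hy]
        exact ConnectedComponent.sound hadj.reachable
      rcases hxy with ⟨rfl, rfl⟩ | ⟨rfl, rfl⟩
      · exact ⟨hadj, by rintro z (rfl | rfl) <;> assumption⟩
      · exact ⟨hadj.symm, by rintro z (rfl | rfl) <;> assumption⟩
  rw [hset, Set.ncard_coe_finset, Finset.card_image_of_injOn]
  · rw [Finset.card_eq_sum_card_fiberwise (f := Prod.snd) (t := (Set.toFinite C.supp).toFinset)]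
    · refine Finset.sum_congr rfl ?_
      intro v hv
      unfold indeg
      congr 1
      ext p
      simp only [Finset.mem_filter]
      constructor
      · rintro ⟨⟨h1, _⟩, h2⟩; exact ⟨h1, h2⟩
      · rintro ⟨h1, rfl⟩; exact ⟨⟨h1, by simpa using hv⟩, rfl⟩
    · intro p hp
      simpa using (Finset.mem_filter.1 hp).2
  · rintro ⟨a, b⟩ hp ⟨c, d⟩ hq e
    simp only [Sym2.eq_iff] at e
    rcases e with ⟨rfl, rfl⟩ | ⟨rfl, rfl⟩
    · rfl
    · exact absurd (Finset.mem_filter.1 hq).1 (h.asym _ (Finset.mem_filter.1 hp).1)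

theorem Orient.flip_one [DecidableEq V] {H : SimpleGraph V} {O : Finset (V × V)}
    (h : Orient H O) (p : V × V) (hp : p ∈ O) :
    Orient H (insert p.swap (O.erase p)) ∧ ∀ x, (Even (indeg (insert p.swap (O.erase p)) x) ↔
      (Even (indeg O x) ↔ (x = p.1 ↔ x = p.2))) := by
  have hs := h.asym p hp
  obtain ⟨a, b⟩ := p
  have hab : a ≠ b := ((h.adj a b).2 (Or.inl hp)).ne
  simp only [Prod.swap_prod_mk] at hs ⊢
  refine ⟨⟨?_, ?_⟩, ?_⟩
  · intro x y
    rw [h.adj]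
    simp only [Finset.mem_insert, Finset.mem_erase, ne_eq, Prod.mk.injEq]
    grind
  · rintro ⟨x, y⟩ hxy
    have := h.asym (x, y)
    simp only [Finset.mem_insert, Finset.mem_erase, ne_eq, Prod.mk.injEq, Prod.swap_prod_mk] at this hxy ⊢
    grind
  · intro x
    have e : indeg O x = indeg (O.erase (a, b)) x + if b = x then 1 else 0 := by
      conv_lhs => rw [← Finset.insert_erase hp]
      rw [indeg_insert _ _ (by simp)]
    rw [indeg_insert _ _ (by simp [hs]), e]
    simp only
    by_cases h1 : x = a
    · subst h1
      simp [hab, hab.symm, Nat.even_add_one]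
    · by_cases h2 : x = b
      · subst h2
        simp [hab, hab.symm, Nat.even_add_one]
      · simp [h1, h2, Ne.symm h1, Ne.symm h2]

theorem iff_aux (A B C D : Prop) : ((D ↔ (A ↔ B)) ↔ (B ↔ C)) ↔ (D ↔ (A ↔ C)) := by
  tauto

theorem Orient.flip [DecidableEq V] {H : SimpleGraph V} {s t : V} (W : H.Walk s t) :
    ∀ {O : Finset (V × V)}, Orient H O → ∃ O', Orient H O' ∧
      ∀ x, (Even (indeg O' x) ↔ (Even (indeg O x) ↔ (x = s ↔ x = t))) := by
  induction W with
  | nil => intro O h; exact ⟨O, h, by simp⟩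
  | @cons u v w e W ih =>
    intro O h
    have : ∃ O', Orient H O' ∧ ∀ x, (Even (indeg O' x) ↔ (Even (indeg O x) ↔ (x = u ↔ x = v))) := by
      rcases (h.adj _ _).1 e with hh | hh
      · exact ⟨_, h.flip_one _ hh⟩
      · obtain ⟨h1, h2⟩ := h.flip_one _ hh
        refine ⟨_, h1, fun x => ?_⟩
        rw [h2 x]
        tauto
    obtain ⟨O1, h1, e1⟩ := this
    obtain ⟨O2, h2, e2⟩ := ih h1
    refine ⟨O2, h2, fun x => ?_⟩
    rw [e2, e1]
    exact iff_aux _ _ _ _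

theorem Orient.exists [Fintype V] [DecidableEq V] (H : SimpleGraph V) : ∃ O, Orient H O := by
  classical
  let f := Fintype.equivFin V
  refine ⟨Finset.univ.filter (fun p => H.Adj p.1 p.2 ∧ f p.1 < f p.2), ?_, ?_⟩
  · intro a b
    simp only [Finset.mem_filter, Finset.mem_univ, true_and]
    constructor
    · intro h
      have : f a ≠ f b := fun e => h.ne (f.injective e)
      rcases lt_or_gt_of_ne this with hl | hl
      · exact Or.inl ⟨h, hl⟩
      · exact Or.inr ⟨h.symm, hl⟩
    · rintro (h | h)
      · exact h.1
      · exact h.1.symm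
  · intro p hp hq
    simp only [Finset.mem_filter, Finset.mem_univ, true_and, Prod.fst_swap, Prod.snd_swap] at hp hq
    exact absurd hp.2 hq.2.le.not_gt

theorem Orient.exists_even [Fintype V] [DecidableEq V] {H : SimpleGraph V} {S : Set V}
    (hC : ∀ C : H.ConnectedComponent, Even (componentEdgeCount H C) ∨ ∃ v ∈ S, v ∈ C.supp) :
    ∃ O, Orient H O ∧ ∀ v ∉ S, Even (indeg O v) := by
  classical
  let bad : Finset (V × V) → Finset V := fun O => Finset.univ.filter (fun v => v ∉ S ∧ ¬ Even (indeg O v))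
  have hex : ∃ n, ∃ O, Orient H O ∧ (bad O).card = n := by
    obtain ⟨O, hO⟩ := Orient.exists H
    exact ⟨_, O, hO, rfl⟩
  obtain ⟨O, hO, hn⟩ := Nat.find_spec hex
  have hmin : ∀ O', Orient H O' → (bad O).card ≤ (bad O').card := by
    intro O' h'
    rw [hn]
    exact Nat.find_min' hex ⟨O', h', rfl⟩
  refine ⟨O, hO, ?_⟩
  by_contra hcon
  push Not at hcon
  obtain ⟨v, hvS, hv⟩ := hcon
  have main : ∃ t, H.Reachable v t ∧ t ≠ v ∧ (t ∈ S ∨ ¬ Even (indeg O t)) := by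
    rcases hC (H.connectedComponentMk v) with he | ⟨t, htS, ht⟩
    · by_contra hno
      push Not at hno
      rw [hO.count] at he
      have hvm : v ∈ (Set.toFinite (H.connectedComponentMk v).supp).toFinset := by simp
      rw [← Finset.add_sum_erase _ _ hvm, Nat.even_add] at he
      refine hv (he.2 ?_)
      refine Finset.even_sum _ fun t ht => ?_
      rw [Finset.mem_erase] at ht
      have h2 := ht.2
      simp only [Set.Finite.mem_toFinset, ConnectedComponent.mem_supp_iff,
        ConnectedComponent.eq] at h2
      exact (hno t h2.symm ht.1).2
    · refine ⟨t, ?_, ?_, Or.inl htS⟩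
      · rw [ConnectedComponent.mem_supp_iff, ConnectedComponent.eq] at ht
        exact ht.symm
      · rintro rfl; exact hvS htS
  obtain ⟨t, ⟨W⟩, htv, ht⟩ := main
  obtain ⟨O', hO', he⟩ := Orient.flip W hO
  have hlt : (bad O').card < (bad O).card := by
    apply Finset.card_lt_card
    rw [Finset.ssubset_iff_of_subset]
    · refine ⟨v, by simpa [bad, hvS] using hv, ?_⟩
      simp only [bad, Finset.mem_filter, Finset.mem_univ, true_and, he]
      simp [hv, htv.symm]
    · intro x hx
      simp only [bad, Finset.mem_filter, Finset.mem_univ, true_and, he] at hx ⊢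
      refine ⟨hx.1, ?_⟩
      by_cases h1 : x = v
      · rw [h1]; exact hv
      · by_cases h2 : x = t
        · subst h2
          rcases ht with ht | ht
          · exact absurd ht hx.1
          · exact ht
        · simpa [h1, h2] using hx.2
  exact absurd (hmin O' hO') (by omega)

theorem Orient.even_of [Fintype V] [DecidableEq V] {H : SimpleGraph V} {S : Set V}
    {O : Finset (V × V)} (hO : Orient H O) (he : ∀ v ∉ S, Even (indeg O v))
    (C : H.ConnectedComponent) : Even (componentEdgeCount H C) ∨ ∃ v ∈ S, v ∈ C.supp := by
  by_cases h : ∃ v ∈ S, v ∈ C.supp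
  · exact Or.inr h
  · left
    push Not at h
    rw [hO.count]
    refine Finset.even_sum _ fun t ht => he t fun hS => h t hS ?_
    simpa using ht

theorem chain_index {α : Type*} (R : α → α → Prop) (L : List α) (hL : 0 < L.length) :
    Cycle.Chain R (L : Cycle α) ↔
      ∀ i (h : i < L.length), R L[i] (L[(i + 1) % L.length]'(Nat.mod_lt _ hL)) := by
  have hne : L ≠ [] := List.ne_nil_of_length_pos hL
  rw [chain_single R L hne, List.isChain_iff_getElem]
  constructor
  · rintro ⟨h1, h2⟩ i hi
    by_cases hi' : i + 1 < L.length
    · simp only [Nat.mod_eq_of_lt hi']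
      exact h1 i hi'
    · have e : i = L.length - 1 := by omega
      subst e
      have e2 : (L.length - 1 + 1) % L.length = 0 := by
        rw [Nat.sub_add_cancel hL, Nat.mod_self]
      simp only [e2]
      rw [List.getLast_eq_getElem, List.head_eq_getElem] at h2
      exact h2
  · intro h
    constructor
    · intro i hi
      have := h i (by omega)
      simp only [Nat.mod_eq_of_lt hi] at this
      exact this
    · have := h (L.length - 1) (by omega)
      have e2 : (L.length - 1 + 1) % L.length = 0 := by
        rw [Nat.sub_add_cancel hL, Nat.mod_self]
      simp only [e2] at this
      rw [List.getLast_eq_getElem, List.head_eq_getElem]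
      exact this

/-- the list of traversed ordered pairs -/
def dl {G : SimpleGraph V} {x y : V} (w : G.Walk x y) : List (V × V) := w.darts.map Dart.toProd

theorem dl_length {G : SimpleGraph V} {x y : V} (w : G.Walk x y) : (dl w).length = w.length := by
  simp [dl]

theorem dl_get {G : SimpleGraph V} {x y : V} (w : G.Walk x y) (i : ℕ) (h : i < (dl w).length) :
    (dl w)[i] = (w.getVert i, w.getVert (i + 1)) := by
  simp only [dl, List.getElem_map]
  rw [Walk.darts_getElem_eq_getVert]

theorem getVert_mod {G : SimpleGraph V} {x : V} (w : G.Walk x x) (k : ℕ) (h : k ≤ w.length) :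
    w.getVert (k % w.length) = w.getVert k := by
  rcases h.lt_or_eq with h | rfl
  · rw [Nat.mod_eq_of_lt h]
  · simp

theorem dl_chain {G : SimpleGraph V} {x : V} (w : G.Walk x x) :
    Cycle.Chain (fun p q : V × V => p.2 = q.1) (dl w : Cycle (V × V)) := by
  by_cases h : 0 < (dl w).length
  · rw [chain_index _ _ h]
    intro i hi
    rw [dl_get, dl_get]
    rw [dl_length] at hi
    simp only [dl_length]
    rw [getVert_mod w _ (by omega)]
  · have : dl w = [] := List.length_eq_zero_iff.1 (by omega)
    rw [this]; simp

theorem rep_iff {G : SimpleGraph V} {x : V} (w : G.Walk x x) (v : V) (N : Set V) :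
    HasRepetition w v N ↔
      Cycle.Chain (fun p q : V × V => p.2 = v → (p.1 ∈ N ↔ q.2 ∈ N)) (dl w : Cycle (V × V)) := by
  by_cases h : 0 < (dl w).length
  · rw [chain_index _ _ h]
    have hn : 0 < w.length := by rwa [dl_length] at h
    constructor
    · intro hr j hj
      rw [dl_get, dl_get]
      rw [dl_length] at hj
      simp only [dl_length]
      intro hv
      have hlt := Nat.mod_lt (j + 1) hn
      have := hr ((j + 1) % w.length) hlt (by rw [getVert_mod w _ (by omega)]; exact hv)
      have e : ((j + 1) % w.length + w.length - 1) % w.length = j := by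
        rcases Nat.lt_or_ge (j + 1) w.length with h1 | h1
        · rw [Nat.mod_eq_of_lt h1, show j + 1 + w.length - 1 = j + w.length by omega,
            Nat.add_mod_right, Nat.mod_eq_of_lt hj]
        · have : j + 1 = w.length := by omega
          rw [this, Nat.mod_self, Nat.mod_eq_of_lt (by omega)]
          omega
      rw [e, getVert_mod w ((j + 1) % w.length + 1) (by omega)] at this
      exact this
    · intro hr i hi hv
      have hlt := Nat.mod_lt (i + w.length - 1) hn
      have := hr ((i + w.length - 1) % w.length) (by rw [dl_length]; exact hlt)
      rw [dl_get, dl_get] at this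
      simp only [dl_length] at this
      have e : ((i + w.length - 1) % w.length + 1) % w.length = i := by
        rcases Nat.eq_zero_or_pos i with rfl | h1
        · rw [Nat.mod_eq_of_lt (show 0 + w.length - 1 < w.length by omega), show 0 + w.length - 1 + 1 = w.length by omega, Nat.mod_self]
        · rw [show i + w.length - 1 = i - 1 + w.length by omega, Nat.add_mod_right,
            Nat.mod_eq_of_lt (show i - 1 < w.length by omega),
            Nat.mod_eq_of_lt (show i - 1 + 1 < w.length by omega)]
          omega
      rw [← getVert_mod w ((i + w.length - 1) % w.length + 1) (by omega), e] at this
      rw [getVert_mod w (i + 1) (by omega)]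
      exact this hv
  · have h0 : dl w = [] := List.length_eq_zero_iff.1 (by omega)
    have hn : w.length = 0 := by rw [← dl_length, h0]; rfl
    rw [h0]
    constructor
    · intro _; simp
    · intro _ i hi; omega

theorem mem_dl_adj {G : SimpleGraph V} {x y : V} (w : G.Walk x y) {p : V × V} (hp : p ∈ dl w) :
    G.Adj p.1 p.2 := by
  simp only [dl, List.mem_map] at hp
  obtain ⟨d, -, rfl⟩ := hp
  exact d.adj

theorem Tr.of_walk [DecidableEq V] {G : SimpleGraph V} {S : Set V} {x : V} (w : G.Walk x x)
    (hA : IsAntiparallel w)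
    (hS : ∀ v ∉ S, ∀ N : Set V, N ⊆ G.neighborSet v → N.Nonempty → N ≠ G.neighborSet v →
          ¬ HasRepetition w v N) :
    Tr S (dl w) ∧ ∀ a b, (a, b) ∈ dl w ↔ G.Adj a b := by
  have hm : ∀ a b, (a, b) ∈ dl w ↔ G.Adj a b := by
    intro a b
    refine ⟨fun h => mem_dl_adj w h, fun h => ?_⟩
    have := (hA a b h).1
    unfold traversals at this
    exact List.count_pos_iff.1 (by unfold dl; omega)
  refine ⟨⟨?_, ?_, ?_, dl_chain w, ?_⟩, hm⟩
  · rw [List.nodup_iff_count_le_one]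
    rintro ⟨a, b⟩
    by_cases h : G.Adj a b
    · exact (hA a b h).1.le
    · rw [List.count_eq_zero_of_not_mem (by rwa [hm])]
      omega
  · rintro ⟨a, b⟩ h
    rw [hm] at h
    simpa [hm] using h.symm
  · intro p hp
    exact (mem_dl_adj w hp).ne
  · rintro χ hχ ⟨v, a⟩ ha ⟨v', b⟩ hb e hv
    simp only at e hv
    subst e
    rw [hm] at ha hb
    by_contra hne
    refine hS v hv {c | G.Adj v c ∧ χ (v, c)} (fun c hc => hc.1) ?_ ?_ ?_
    · by_cases h1 : χ (v, a)
      · exact ⟨a, ha, h1⟩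
      · exact ⟨b, hb, by tauto⟩
    · intro he
      have h1 : a ∈ {c | G.Adj v c ∧ χ (v, c)} := by rw [he]; exact ha
      have h2 : b ∈ {c | G.Adj v c ∧ χ (v, c)} := by rw [he]; exact hb
      exact hne ⟨fun _ => h2.2, fun _ => h1.2⟩
    · rw [rep_iff]
      have hc := dl_chain w
      by_cases h0 : 0 < (dl w).length
      · rw [chain_index _ _ h0] at hc hχ ⊢
        intro i hi hv'
        have h1 := hc i hi
        have h2 := hχ i hi
        have m1 := mem_dl_adj w (List.getElem_mem hi)
        have m2 := mem_dl_adj w (List.getElem_mem (Nat.mod_lt (i + 1) h0))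
        revert h1 h2 hv' m1 m2
        generalize (dl w)[i] = p
        generalize (dl w)[(i + 1) % (dl w).length]'(Nat.mod_lt (i + 1) h0) = q
        obtain ⟨p1, p2⟩ := p
        obtain ⟨q1, q2⟩ := q
        simp only [Prod.swap_prod_mk]
        rintro rfl rfl h2 m1 m2
        exact ⟨fun hh => ⟨m2, h2.1 hh.2⟩, fun hh => ⟨m1.symm, h2.2 hh.2⟩⟩
      · have h0 : dl w = [] := List.length_eq_zero_iff.1 (by omega)
        rw [h0]; simp

theorem walk_of_chain {G : SimpleGraph V} : ∀ (l : List (V × V)) (p : V × V),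
    (p :: l).IsChain (fun p q : V × V => p.2 = q.1) → (∀ q ∈ p :: l, G.Adj q.1 q.2) →
    ∃ w : G.Walk p.1 ((p :: l).getLast (by simp)).2, dl w = p :: l := by
  intro l
  induction l with
  | nil =>
    intro p _ h
    exact ⟨Walk.cons (h p (by simp)) Walk.nil, by simp [dl]⟩
  | cons r l ih =>
    intro p hc h
    rw [List.isChain_cons_cons] at hc
    obtain ⟨w, hw⟩ := ih r hc.2 (fun q hq => h q (List.mem_cons_of_mem _ hq))
    have ha : G.Adj p.1 r.1 := hc.1 ▸ h p (by simp)
    refine ⟨Walk.cons ha w, ?_⟩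
    have e : dl (Walk.cons ha w) = (p.1, r.1) :: dl w := by simp [dl]
    have e2 : (p.1, r.1) = p := by rw [← hc.1]
    exact e.trans (congrArg₂ List.cons e2 hw)

theorem count_mk [DecidableEq V] (a b : V) (hab : a ≠ b) (L : List (V × V)) :
    (L.map (fun p => s(p.1, p.2))).count s(a, b) = L.count (a, b) + L.count (b, a) := by
  induction L with
  | nil => simp
  | cons p L ih =>
    obtain ⟨x, y⟩ := p
    simp only [List.map_cons, List.count_cons, ih, beq_iff_eq, Sym2.eq_iff, Prod.mk.injEq]
    by_cases h1 : x = a ∧ y = b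
    · have : ¬ (x = b ∧ y = a) := by rintro ⟨rfl, _⟩; exact hab h1.1.symm
      simp [h1, this, hab, hab.symm]; omega
    · by_cases h2 : x = b ∧ y = a
      · simp [h2, hab, hab.symm]; omega
      · simp [h1, h2]

theorem Tr.to_walk [DecidableEq V] {G : SimpleGraph V} (hG : G.Connected) {S : Set V}
    {L : List (V × V)} (h : Tr S L) (hm : ∀ a b, (a, b) ∈ L ↔ G.Adj a b) :
    ∃ (x : V) (w : G.Walk x x), IsDoubleTrace w ∧ IsAntiparallel w ∧
        ∀ v ∉ S, ∀ N : Set V, N ⊆ G.neighborSet v → N.Nonempty → N ≠ G.neighborSet v →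
          ¬ HasRepetition w v N := by
  have hw : ∃ (x : V) (w : G.Walk x x), dl w = L := by
    cases L with
    | nil =>
      obtain ⟨x⟩ := hG.nonempty
      exact ⟨x, Walk.nil, by simp [dl]⟩
    | cons p l =>
      obtain ⟨h1, h2⟩ := (chain_single _ _ (by simp)).1 h.chain
      obtain ⟨w, hw⟩ := walk_of_chain (G := G) l p h1 (fun q hq => (hm _ _).1 hq)
      simp only [List.head_cons] at h2
      refine ⟨p.1, w.copy rfl h2, ?_⟩
      have h3 : dl (w.copy rfl h2) = dl w := by simp [dl]
      exact h3.trans hw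
  obtain ⟨x, w, rfl⟩ := hw
  have hc : ∀ a b, G.Adj a b → (dl w).count (a, b) = 1 := fun a b hab =>
    List.count_eq_one_of_mem h.nodup ((hm a b).2 hab)
  refine ⟨x, w, ?_, ?_, ?_⟩
  · intro e
    induction e with
    | _ a b =>
    intro hab
    rw [mem_edgeSet] at hab
    have e : w.edges = (dl w).map (fun p => s(p.1, p.2)) := by
      simp only [dl, Walk.edges_eq_map_darts, List.map_map]
      rfl
    rw [e, count_mk a b hab.ne, hc _ _ hab, hc _ _ hab.symm]
  · intro a b hab
    exact ⟨hc a b hab, hc b a hab.symm⟩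
  · intro v hv N hN hne hNe hr
    rw [rep_iff] at hr
    have hch := h.chain
    obtain ⟨a, ha⟩ := hne
    have h0 : 0 < (dl w).length := List.length_pos_of_mem ((hm v a).2 (hN ha))
    have := h.norep (fun p => p.1 = v → p.2 ∈ N) ?_
    · apply hNe
      refine Set.Subset.antisymm hN fun b hb => ?_
      have := this (v, a) ((hm v a).2 (hN ha)) (v, b) ((hm v b).2 hb) rfl hv
      simp only [true_imp_iff] at this
      exact this.1 ha
    · rw [chain_index _ _ h0] at hr hch ⊢
      intro i hi
      have h1 := hch i hi
      have h2 := hr i hi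
      simp only [Prod.fst_swap, Prod.snd_swap]
      rw [← h1]
      exact imp_congr_right h2

end ADT

/-- A finite connected simple graph admits an antiparallel double trace whose nontrivial
repetitions all occur at vertices of `S` iff there is a spanning tree such that every co-tree
component has an even number of edges or contains a vertex of `S`. -/
theorem exists_antiparallel_double_trace_repetitions_in_iff {V : Type*} [Fintype V]
    [DecidableEq V] (G : SimpleGraph V) (hG : G.Connected) (S : Set V) :
    (∃ (x : V) (w : G.Walk x x), IsDoubleTrace w ∧ IsAntiparallel w ∧
        ∀ v ∉ S, ∀ N : Set V, N ⊆ G.neighborSet v → N.Nonempty → N ≠ G.neighborSet v →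
          ¬ HasRepetition w v N) ↔
      ∃ T : SimpleGraph V, IsSpanningTree G T ∧
        ∀ C : (G \ T).ConnectedComponent,
          Even (componentEdgeCount (G \ T) C) ∨ ∃ v ∈ S, v ∈ C.supp := by

  constructor
  · rintro ⟨x, w, -, hA, hS⟩
    obtain ⟨h, hm⟩ := ADT.Tr.of_walk w hA hS
    obtain ⟨F, O, h1, h2, h3, h4, h5, h6⟩ := ADT.Tr.forward _ _ rfl h
    have hadj : ∀ a b, G.Adj a b ↔ F.Adj a b ∨ (a, b) ∈ O ∨ (b, a) ∈ O := by
      intro a b; rw [← hm, h4]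
    have hle : F ≤ G := fun a b hab => (hadj a b).2 (Or.inl hab)
    refine ⟨F, ⟨hle, ?_, h1⟩, ?_⟩
    · have hne := hG.nonempty
      refine Connected.mk fun a b => ?_
      obtain ⟨W⟩ := hG.preconnected a b
      induction W with
      | nil => exact Reachable.refl _
      | cons e W ih => exact (h5 _ ((hm _ _).2 e)).trans ih
    · have hO : ADT.Orient (G \ F) O := by
        refine ⟨fun a b => ?_, h2⟩
        rw [sdiff_adj, hadj]
        constructor
        · rintro ⟨h | h, hn⟩
          · exact absurd h hn
          · exact h
        · intro h
          refine ⟨Or.inr h, fun hn => ?_⟩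
          rcases h with h | h
          · exact h3 _ h hn
          · exact h3 _ h hn.symm
      exact hO.even_of h6
  · rintro ⟨T, ⟨hle, hT, hA⟩, hC⟩
    obtain ⟨O, hO, he⟩ := ADT.Orient.exists_even hC
    obtain ⟨L, h, hm⟩ := ADT.tree_trace (S := S) hT hA
    have hOadj : ∀ p ∈ O, G.Adj p.1 p.2 ∧ ¬ T.Adj p.1 p.2 := by
      intro p hp
      have := (hO.adj p.1 p.2).2 (Or.inl hp)
      rwa [sdiff_adj] at this
    have hfin : ∃ L', ADT.Tr S L' ∧ ∀ p, p ∈ L' ↔ p ∈ L ∨ p ∈ O ∨ p.swap ∈ O := by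
      rcases O.eq_empty_or_nonempty with rfl | ⟨p, hp⟩
      · exact ⟨L, h, by simp⟩
      · refine ADT.Tr.backward _ O rfl L h ?_ ?_ hO.asym ?_ he
        · intro v
          have hnt : Nontrivial V := ⟨p.1, p.2, (hOadj p hp).1.ne⟩
          obtain ⟨b, hb⟩ := hT.preconnected.exists_adj_of_nontrivial v
          exact ⟨(v, b), (hm v b).2 hb, rfl⟩
        · exact fun p hp => (hOadj p hp).1.ne
        · exact fun p hp hq => (hOadj p hp).2 ((hm _ _).1 hq)
    obtain ⟨L', h', hm'⟩ := hfin
    refine h'.to_walk hG fun a b => ?_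
    rw [hm', hm]
    simp only [Prod.swap_prod_mk]
    rw [← hO.adj, sdiff_adj]
    constructor
    · rintro (h | h)
      · exact hle h
      · exact h.1
    · intro h
      by_cases hh : T.Adj a b
      · exact Or.inl hh
      · exact Or.inr ⟨h, hh⟩
end

section
/- Let G be a finite connected simple graph, V a subset of V(G), and v_1, ..., v_l vertices of G that are pairwise nonadjacent and have pairwise disjoint neighbourhoods. Let G' be the simple graph obtained from G by identifying v_1, ..., v_l to a single new vertex v (the neighbours of v in G' are the union of the neighbourhoods of v_1, ..., v_l, and all other vertices and edges of G are unchanged). If G has a spanning tree T with the property that every connected component of the co-tree G - E(T) has an even number of edges or contains a vertex of V, then G' has a spanning tree T' with the property that every connected component of the co-tree G' - E(T') has an even number of edges, or contains a vertex that is the image of a vertex of V, or contains v. -/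
open SimpleGraph

/-- Identifying a set `S` of pairwise nonadjacent vertices with pairwise disjoint
neighbourhoods to a single new vertex `v` (via the quotient map `f`): if `G` has a spanning
tree whose co-tree components are even or contain a vertex of `Vset`, then the identified
graph `G'` has a spanning tree whose co-tree components are even, contain the image of a
vertex of `Vset`, or contain `v`. -/
theorem identify_vertices_spanning_tree {V V' : Type*} [Fintype V] [Fintype V']
    [DecidableEq V] [DecidableEq V']
    (G : SimpleGraph V) (hG : G.Connected) (Vset : Set V) (S : Set V) (hSne : S.Nonempty)
    (hnonadj : ∀ a ∈ S, ∀ b ∈ S, ¬ G.Adj a b)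
    (hnbhd : ∀ a ∈ S, ∀ b ∈ S, a ≠ b → Disjoint (G.neighborSet a) (G.neighborSet b))
    (G' : SimpleGraph V') (f : V → V') (v : V')
    (hsurj : Function.Surjective f)
    (hfv : ∀ x : V, f x = v ↔ x ∈ S)
    (hinj : ∀ x y : V, x ∉ S → y ∉ S → f x = f y → x = y)
    (hadj : ∀ x' y' : V', G'.Adj x' y' ↔ ∃ x y : V, f x = x' ∧ f y = y' ∧ G.Adj x y)
    (T : SimpleGraph V) (hT : IsSpanningTree G T)
    (hTcomp : ∀ C : (G \ T).ConnectedComponent,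
      Even (componentEdgeCount (G \ T) C) ∨ ∃ u ∈ Vset, u ∈ C.supp) :
    ∃ T' : SimpleGraph V', IsSpanningTree G' T' ∧
      ∀ C : (G' \ T').ConnectedComponent,
        Even (componentEdgeCount (G' \ T') C) ∨
          (∃ u ∈ Vset, f u ∈ C.supp) ∨ v ∈ C.supp := by
  classical
  obtain ⟨hTG, hTc, hTa⟩ := hT
  have key : ∀ a b p q : V, G.Adj a b → G.Adj p q → f p = f a → f q = f b → p = a ∧ q = b := by
    intro a b p q hab hpq h1 h2
    have hS1 : p ∈ S ↔ a ∈ S := by rw [← hfv, ← hfv, h1]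
    have hS2 : q ∈ S ↔ b ∈ S := by rw [← hfv, ← hfv, h2]
    by_cases ha : a ∈ S
    · have hb : b ∉ S := fun hb => hnonadj a ha b hb hab
      have hqb : q = b := hinj q b (fun h => hb (hS2.1 h)) hb h2
      refine ⟨?_, hqb⟩
      by_contra hne
      subst hqb
      exact Set.disjoint_left.1 (hnbhd p (hS1.2 ha) a ha hne) hpq hab
    · have hpa : p = a := hinj p a (fun h => ha (hS1.1 h)) ha h1
      refine ⟨hpa, ?_⟩
      by_cases hb : b ∈ S
      · by_contra hne
        subst hpa
        exact Set.disjoint_left.1 (hnbhd q (hS2.2 hb) b hb hne) hpq.symm hab.symm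
      · exact hinj q b (fun h => hb (hS2.1 h)) hb h2
  obtain ⟨g, hg⟩ := hsurj.hasRightInverse
  have hgf : ∀ a, a ∉ S → g (f a) = a := by
    intro a ha
    refine hinj _ _ (fun h => ?_) ha (hg _)
    rw [← hfv, hg, hfv] at h
    exact ha h
  let H : SimpleGraph V' :=
    { Adj := fun x y => ∃ a b, f a = x ∧ f b = y ∧ T.Adj a b
      symm := ⟨fun x y ⟨a, b, h1, h2, h⟩ => ⟨b, a, h2, h1, h.symm⟩⟩
      loopless := ⟨fun x ⟨a, b, h1, h2, h⟩ =>
        G'.loopless.irrefl x ((hadj x x).2 ⟨a, b, h1, h2, hTG h⟩)⟩ }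
  have hHG : H ≤ G' := by
    intro x y ⟨a, b, h1, h2, h⟩
    exact (hadj x y).2 ⟨a, b, h1, h2, hTG h⟩
  have hHc : H.Connected :=
    hTc.map (⟨f, fun {a b} h => ⟨a, b, rfl, rfl, h⟩⟩ : T →g H) hsurj
  let F : SimpleGraph V' :=
    { Adj := fun x y => x ≠ v ∧ y ≠ v ∧ H.Adj x y
      symm := ⟨fun x y ⟨h1, h2, h⟩ => ⟨h2, h1, h.symm⟩⟩
      loopless := ⟨fun x ⟨_, _, h⟩ => H.loopless.irrefl x h⟩ }
  have hFH : F ≤ H := fun x y h => h.2.2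
  have hFa : F.IsAcyclic := by
    refine hTa.comap (⟨g, ?_⟩ : F →g T) hg.injective
    rintro x y ⟨hx, hy, a, b, rfl, rfl, h⟩
    rw [hgf a (fun h => hx ((hfv a).2 h)), hgf b (fun h => hy ((hfv b).2 h))]
    exact h
  obtain ⟨T', hFT, hTH, hT'⟩ := hHc.exists_isTree_le_of_le_of_isAcyclic hFH hFa
  refine ⟨T', ⟨hTH.trans hHG, hT'.1, hT'.2⟩, ?_⟩
  have hmap : ∀ a b, (G \ T).Adj a b → (G' \ T').Adj (f a) (f b) := by
    rintro a b ⟨h, hn⟩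
    refine ⟨(hadj _ _).2 ⟨a, b, rfl, rfl, h⟩, fun ht => hn ?_⟩
    obtain ⟨p, q, h1, h2, hpq⟩ := hTH ht
    obtain ⟨rfl, rfl⟩ := key a b p q h (hTG hpq) h1 h2
    exact hpq
  have hback : ∀ y z, y ≠ v → z ≠ v → (G' \ T').Adj y z → (G \ T).Adj (g y) (g z) := by
    rintro y z hy hz ⟨h, hn⟩
    obtain ⟨a, b, rfl, rfl, hab⟩ := (hadj _ _).1 h
    rw [hgf a (fun h => hy ((hfv a).2 h)), hgf b (fun h => hz ((hfv b).2 h))]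
    exact ⟨hab, fun ht => hn (hFT ⟨hy, hz, a, b, rfl, rfl, ht⟩)⟩
  intro C
  by_cases hvC : v ∈ C.supp
  · exact Or.inr (Or.inr hvC)
  have hCv : ∀ y ∈ C.supp, y ≠ v := fun y hy h => hvC (h ▸ hy)
  obtain ⟨x, rfl⟩ := C.exists_rep
  change v ∉ ((G' \ T').connectedComponentMk x).supp at hvC
  change ∀ y ∈ ((G' \ T').connectedComponentMk x).supp, y ≠ v at hCv
  change Even (componentEdgeCount _ ((G' \ T').connectedComponentMk x)) ∨
    (∃ u ∈ Vset, f u ∈ ((G' \ T').connectedComponentMk x).supp) ∨ _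
  have hDC : ∀ a ∈ ((G \ T).connectedComponentMk (g x)).supp,
      f a ∈ ((G' \ T').connectedComponentMk x).supp := by
    intro a ha
    rw [ConnectedComponent.mem_supp_iff, ConnectedComponent.eq] at ha ⊢
    have := ha.map (⟨f, fun {a b} h => hmap a b h⟩ : (G \ T) →g (G' \ T'))
    simpa [hg x] using this
  have hCD : ∀ y ∈ ((G' \ T').connectedComponentMk x).supp,
      g y ∈ ((G \ T).connectedComponentMk (g x)).supp := by
    intro y hy
    rw [ConnectedComponent.mem_supp_iff, ConnectedComponent.eq] at hy ⊢
    obtain ⟨w⟩ := hy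
    induction w with
    | nil => exact Reachable.refl _
    | @cons y z x h w ih =>
      have hz : z ∈ ((G' \ T').connectedComponentMk x).supp := by
        rw [ConnectedComponent.mem_supp_iff, ConnectedComponent.eq]
        exact ⟨w⟩
      have hy : y ∈ ((G' \ T').connectedComponentMk x).supp := by
        rw [ConnectedComponent.mem_supp_iff, ConnectedComponent.eq]
        exact ⟨Walk.cons h w⟩
      exact (hback y z (hCv y hy) (hCv z hz) h).reachable.trans (ih hvC hCv hDC)
  have hDS : ∀ a ∈ ((G \ T).connectedComponentMk (g x)).supp, g (f a) = a := fun a ha =>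
    hgf a (fun h => hCv _ (hDC a ha) ((hfv a).2 h))
  have hcount : componentEdgeCount (G' \ T') ((G' \ T').connectedComponentMk x) =
      componentEdgeCount (G \ T) ((G \ T).connectedComponentMk (g x)) := by
    unfold componentEdgeCount
    symm
    refine Set.ncard_congr (fun e _ => Sym2.map f e) ?_ ?_ ?_
    · intro e
      induction e with | _ a b =>
      rintro ⟨h, hs⟩
      refine ⟨hmap a b h, ?_⟩
      intro c hc
      obtain ⟨d, hd, rfl⟩ := Sym2.mem_map.1 hc
      exact hDC d (hs d hd)
    · intro e e' he he' h
      have aux : ∀ e : Sym2 V, (∀ a ∈ e, a ∈ ((G \ T).connectedComponentMk (g x)).supp) →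
          Sym2.map g (Sym2.map f e) = e := by
        intro e
        induction e with | _ a b =>
        intro hs
        simp only [Sym2.map_mk]
        rw [hDS a (hs a (by simp)), hDS b (hs b (by simp))]
      rw [← aux e he.2, ← aux e' he'.2]
      exact congrArg _ h
    · intro e
      induction e with | _ y z =>
      rintro ⟨h, hs⟩
      have hy := hs y (by simp)
      have hz := hs z (by simp)
      refine ⟨s(g y, g z), ⟨hback y z (hCv y hy) (hCv z hz) h, ?_⟩, ?_⟩
      · intro a ha
        rcases Sym2.mem_iff.1 ha with rfl | rfl
        · exact hCD y hy
        · exact hCD z hz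
      · simp only [Sym2.map_mk]
        rw [hg y, hg z]
  rcases hTcomp ((G \ T).connectedComponentMk (g x)) with h | ⟨u, hu, huD⟩
  · exact Or.inl (hcount ▸ h)
  · exact Or.inr (Or.inl ⟨u, hu, hDC u huD⟩)
end

section
/- Let G be a finite connected simple graph, V a subset of V(G), and let v_{1,1}, ..., v_{1,l_1}, ..., v_{k,1}, ..., v_{k,l_k} be vertices of G that are pairwise nonadjacent and have pairwise disjoint neighbourhoods. Let G' be the simple graph obtained from G by, for each i = 1, ..., k, identifying the vertices v_{i,1}, ..., v_{i,l_i} to a single new vertex v_i (the neighbours of v_i in G' are the union of the neighbourhoods of v_{i,1}, ..., v_{i,l_i}, and all other vertices and edges of G are unchanged). If G has a spanning tree T with the property that every connected component of the co-tree G - E(T) has an even number of edges or contains a vertex of V, then G' has a spanning tree T' with the property that every connected component of the co-tree G' - E(T') has an even number of edges, or contains a vertex that is the image of a vertex of V, or contains at least one of the new vertices v_1, ..., v_k. -/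
open SimpleGraph

/-- Identifying `k` disjoint classes `S i` of vertices (all the identified vertices pairwise
nonadjacent with pairwise disjoint neighbourhoods), each class `S i` to a new vertex
`newV i`, via the quotient map `f`: if `G` has a spanning tree whose co-tree components are
even or contain a vertex of `Vset`, then the identified graph `G'` has a spanning tree whose
co-tree components are even, contain the image of a vertex of `Vset`, or contain one of the
new vertices `newV i`. -/
theorem identify_vertex_classes_spanning_tree {V V' : Type*} [Fintype V] [Fintype V']
    [DecidableEq V] [DecidableEq V']
    (G : SimpleGraph V) (hG : G.Connected) (Vset : Set V) (k : ℕ) (S : Fin k → Set V)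
    (hSne : ∀ i, (S i).Nonempty)
    (hSdisj : ∀ i j, i ≠ j → Disjoint (S i) (S j))
    (hnonadj : ∀ a ∈ ⋃ i, S i, ∀ b ∈ ⋃ i, S i, ¬ G.Adj a b)
    (hnbhd : ∀ a ∈ ⋃ i, S i, ∀ b ∈ ⋃ i, S i, a ≠ b →
      Disjoint (G.neighborSet a) (G.neighborSet b))
    (G' : SimpleGraph V') (f : V → V') (newV : Fin k → V')
    (hsurj : Function.Surjective f)
    (hnewinj : Function.Injective newV)
    (hfv : ∀ (i : Fin k) (x : V), f x = newV i ↔ x ∈ S i)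
    (hinj : ∀ x y : V, x ∉ (⋃ i, S i) → y ∉ (⋃ i, S i) → f x = f y → x = y)
    (hadj : ∀ x' y' : V', G'.Adj x' y' ↔ ∃ x y : V, f x = x' ∧ f y = y' ∧ G.Adj x y)
    (T : SimpleGraph V) (hT : IsSpanningTree G T)
    (hTcomp : ∀ C : (G \ T).ConnectedComponent,
      Even (componentEdgeCount (G \ T) C) ∨ ∃ u ∈ Vset, u ∈ C.supp) :
    ∃ T' : SimpleGraph V', IsSpanningTree G' T' ∧
      ∀ C : (G' \ T').ConnectedComponent,
        Even (componentEdgeCount (G' \ T') C) ∨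
          (∃ u ∈ Vset, f u ∈ C.supp) ∨ ∃ i : Fin k, newV i ∈ C.supp := by
  classical
  obtain ⟨hTG, hTc, hTa⟩ := hT
  have hU : ∀ x y : V, f x = f y → x ∈ (⋃ i, S i) → y ∈ (⋃ i, S i) := by
    intro x y h hx
    obtain ⟨i, hi⟩ := Set.mem_iUnion.1 hx
    exact Set.mem_iUnion.2 ⟨i, (hfv i y).1 (h ▸ (hfv i x).2 hi)⟩
  have hne : ∀ x y, G.Adj x y → f x ≠ f y := fun x y h he =>
    ((hadj (f x) (f y)).2 ⟨x, y, rfl, rfl, h⟩).ne he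
  have einj : ∀ x y x2 y2, G.Adj x y → G.Adj x2 y2 → f x = f x2 → f y = f y2 →
      x = x2 ∧ y = y2 := by
    have aux : ∀ x y x2 y2, G.Adj x y → G.Adj x2 y2 → f x = f x2 → f y = f y2 →
        x ∈ (⋃ i, S i) → x = x2 ∧ y = y2 := by
      intro x y x2 y2 h h2 hx hy hxU
      have hx2 := hU _ _ hx hxU
      have hyU : y ∉ (⋃ i, S i) := fun hy => hnonadj _ hxU _ hy h
      have hyU2 : y2 ∉ (⋃ i, S i) := fun hy => hnonadj _ hx2 _ hy h2
      have e := hinj _ _ hyU hyU2 hy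
      subst e
      refine ⟨?_, rfl⟩
      by_contra hc
      exact (Set.disjoint_left.1 (hnbhd _ hxU _ hx2 hc) : _) (show y ∈ G.neighborSet x from h) h2
    intro x y x2 y2 h h2 hx hy
    by_cases hxU : x ∈ (⋃ i, S i)
    · exact aux _ _ _ _ h h2 hx hy hxU
    by_cases hyU : y ∈ (⋃ i, S i)
    · exact (aux _ _ _ _ h.symm h2.symm hy hx hyU).symm
    exact ⟨hinj _ _ hxU (fun h => hxU (hU _ _ hx.symm h)) hx,
      hinj _ _ hyU (fun h => hyU (hU _ _ hy.symm h)) hy⟩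
  let F1 : SimpleGraph V' :=
    { Adj := fun x' y' => ∃ x y, f x = x' ∧ f y = y' ∧ T.Adj x y
      symm := ⟨by rintro _ _ ⟨x, y, rfl, rfl, h⟩; exact ⟨y, x, rfl, rfl, h.symm⟩⟩
      loopless := ⟨by rintro _ ⟨x, y, rfl, h2, h⟩; exact hne _ _ (hTG h) h2.symm⟩ }
  let F0 : SimpleGraph V' :=
    { Adj := fun x' y' => ∃ x y, x ∉ (⋃ i, S i) ∧ y ∉ (⋃ i, S i) ∧ f x = x' ∧ f y = y' ∧ T.Adj x y
      symm := ⟨by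
        rintro _ _ ⟨x, y, h1, h2, rfl, rfl, h⟩; exact ⟨y, x, h2, h1, rfl, rfl, h.symm⟩⟩
      loopless := ⟨by rintro _ ⟨x, y, _, _, rfl, h2, h⟩; exact hne _ _ (hTG h) h2.symm⟩ }
  have hF1c : F1.Connected :=
    Connected.map (G := T) (H := F1) ⟨f, fun {a b} h => ⟨a, b, rfl, rfl, h⟩⟩ hsurj hTc
  have hF0a : F0.IsAcyclic := by
    have hs := Function.rightInverse_surjInv hsurj
    refine IsAcyclic.comap (G := F0) (G' := T) ⟨Function.surjInv hsurj, ?_⟩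
      (Function.injective_surjInv hsurj) hTa
    rintro _ _ ⟨x, y, hx, hy, rfl, rfl, h⟩
    have e : ∀ z, z ∉ (⋃ i, S i) → Function.surjInv hsurj (f z) = z := fun z hz =>
      hinj _ _ (fun h => hz (hU _ _ (hs (f z)) h)) hz (hs (f z))
    rw [e x hx, e y hy]
    exact h
  have h01 : F0 ≤ F1 := by
    rintro _ _ ⟨x, y, _, _, h1, h2, h⟩; exact ⟨x, y, h1, h2, h⟩
  obtain ⟨T', h0, h1, hT'⟩ := hF1c.exists_isTree_le_of_le_of_isAcyclic h01 hF0a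
  have h1G : F1 ≤ G' := by
    rintro _ _ ⟨x, y, h1, h2, h⟩; exact (hadj _ _).2 ⟨x, y, h1, h2, hTG h⟩
  refine ⟨T', ⟨h1.trans h1G, hT'.1, hT'.2⟩, ?_⟩
  intro C
  by_contra! hcon
  obtain ⟨hodd, hV, hnew⟩ := hcon
  have hCU : ∀ y, f y ∈ C.supp → y ∉ (⋃ i, S i) := by
    intro y hy hyU
    obtain ⟨i, hi⟩ := Set.mem_iUnion.1 hyU
    exact hnew i ((hfv i y).2 hi ▸ hy)
  have hhom : ∀ x y, (G \ T).Adj x y → (G' \ T').Adj (f x) (f y) := by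
    intro x y h
    rw [sdiff_adj] at h ⊢
    refine ⟨(hadj _ _).2 ⟨x, y, rfl, rfl, h.1⟩, fun hc => ?_⟩
    obtain ⟨x2, y2, e1, e2, h2⟩ := h1 hc
    obtain ⟨rfl, rfl⟩ := einj _ _ _ _ (hTG h2) h.1 e1 e2
    exact h.2 h2
  let φ : (G \ T) →g (G' \ T') := ⟨f, fun {a b} h => hhom a b h⟩
  have hback : ∀ x y', f x ∈ C.supp → (G' \ T').Adj (f x) y' →
      ∃ y, f y = y' ∧ (G \ T).Adj x y := by
    intro x y' hx h
    have hy' : y' ∈ C.supp := ConnectedComponent.mem_supp_of_adj_mem_supp C hx h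
    rw [sdiff_adj] at h
    obtain ⟨x2, y, e1, rfl, h2⟩ := (hadj _ _).1 h.1
    have e := hinj _ _ (hCU _ (e1 ▸ hx)) (hCU _ hx) e1
    subst e
    refine ⟨y, rfl, ?_⟩
    rw [sdiff_adj]
    exact ⟨h2, fun hc => h.2 (h0 ⟨x2, y, hCU _ hx, hCU _ hy', rfl, rfl, hc⟩)⟩
  obtain ⟨c, hc⟩ := C.nonempty_supp
  obtain ⟨x, rfl⟩ := hsurj c
  let D := (G \ T).connectedComponentMk x
  have hDC : ∀ y ∈ D.supp, f y ∈ C.supp := by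
    intro y hy
    have hy : (G \ T).Reachable y x := ConnectedComponent.exact hy
    rw [ConnectedComponent.mem_supp_iff] at hc ⊢
    rw [← hc]
    exact ConnectedComponent.sound (hy.map φ)
  have hlift : ∀ a' b' : V', (G' \ T').Walk a' b' → ∀ a ∈ D.supp, f a = a' →
      ∃ b ∈ D.supp, f b = b' := by
    intro a' b' w
    induction w with
    | nil => exact fun a ha e => ⟨a, ha, e⟩
    | cons h _ ih =>
      rintro a ha rfl
      obtain ⟨y, e, hy⟩ := hback _ _ (hDC a ha) h
      exact ih y (ConnectedComponent.mem_supp_of_adj_mem_supp D ha hy) e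
  have hCD : ∀ y, f y ∈ C.supp → y ∈ D.supp := by
    intro y hy
    have : (G' \ T').Reachable (f x) (f y) := ConnectedComponent.exact (hc.trans hy.symm)
    obtain ⟨w⟩ := this
    obtain ⟨b, hb, e⟩ := hlift _ _ w x rfl rfl
    rwa [← hinj _ _ (hCU _ (hDC _ hb)) (hCU _ hy) e]
  have hcount : componentEdgeCount (G' \ T') C = componentEdgeCount (G \ T) D := by
    unfold componentEdgeCount
    rw [← Set.ncard_image_of_injOn (f := Sym2.map f)]
    · congr 1
      ext e
      induction e using Sym2.ind with
      | _ a' b' =>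
      constructor
      · rintro ⟨he, hs⟩
        obtain ⟨a, rfl⟩ := hsurj a'
        have ha := hs (f a) (by simp)
        obtain ⟨b, rfl, hab⟩ := hback _ _ ha he
        have hb := hs (f b) (by simp)
        refine ⟨s(a, b), ⟨hab, ?_⟩, rfl⟩
        intro z hz
        rcases Sym2.mem_iff.1 hz with rfl | rfl
        · exact hCD _ ha
        · exact hCD _ hb
      · rintro ⟨e, ⟨he, hs⟩, heq⟩
        rw [← heq]
        induction e using Sym2.ind with
        | _ a b =>
        refine ⟨hhom a b he, ?_⟩
        intro z hz
        rcases Sym2.mem_iff.1 hz with rfl | rfl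
        · exact hDC _ (hs _ (by simp))
        · exact hDC _ (hs _ (by simp))
    · rintro e ⟨he, -⟩ e2 ⟨he2, -⟩ heq
      induction e using Sym2.ind with
      | _ a b =>
      induction e2 using Sym2.ind with
      | _ a2 b2 =>
      have g1 : G.Adj a b := ((sdiff_adj _ _ _ _).1 he).1
      have g2 : G.Adj a2 b2 := ((sdiff_adj _ _ _ _).1 he2).1
      rcases Sym2.eq_iff.1 heq with ⟨p, q⟩ | ⟨p, q⟩
      · obtain ⟨rfl, rfl⟩ := einj _ _ _ _ g1 g2 p q
        rfl
      · obtain ⟨rfl, rfl⟩ := einj _ _ _ _ g1 g2.symm p q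
        exact Sym2.eq_swap
  rcases hTcomp D with h | ⟨u, hu, hD⟩
  · rw [← hcount] at h
    exact absurd h (by simpa using hodd)
  · exact hV u hu (hDC u hD)
end

section
/- Let G be a finite connected simple graph and d >= 1 an integer. If the minimum degree of G is strictly greater than d and the maximum degree of G is strictly less than 2d + 2, then every d-stable trace of G is a strong trace of G. -/
open SimpleGraph

lemma adj_succ_aux {V : Type*} {G : SimpleGraph V} {x : V} (w : G.Walk x x) (i : ℕ)
    (hi : i < w.length) : G.Adj (w.getVert i) (w.getVert ((i + 1) % w.length)) := by
  have h := w.adj_getVert_succ hi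
  rcases Nat.lt_or_ge (i + 1) w.length with h1 | h1
  · rwa [Nat.mod_eq_of_lt h1]
  · have h2 : i + 1 = w.length := by omega
    rw [h2, Walk.getVert_length] at h
    rwa [h2, Nat.mod_self, Walk.getVert_zero]

lemma adj_pred_aux {V : Type*} {G : SimpleGraph V} {x : V} (w : G.Walk x x) (i : ℕ)
    (hi : i < w.length) :
    G.Adj (w.getVert i) (w.getVert ((i + w.length - 1) % w.length)) := by
  have hl : (i + w.length - 1) % w.length < w.length := Nat.mod_lt _ (by omega)
  have h := adj_succ_aux w _ hl
  have e : ((i + w.length - 1) % w.length + 1) % w.length = i := by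
    rw [Nat.mod_add_mod, show i + w.length - 1 + 1 = i + w.length by omega,
      Nat.add_mod_right, Nat.mod_eq_of_lt hi]
  rw [e] at h
  exact h.symm

lemma hasRepetition_compl_aux {V : Type*} {G : SimpleGraph V} {x : V} (w : G.Walk x x) (v : V)
    (N : Set V) (h : HasRepetition w v N) : HasRepetition w v (G.neighborSet v \ N) := by
  intro i hi hv
  have h1 := adj_succ_aux w i hi
  have h2 := adj_pred_aux w i hi
  have h3 := h i hi hv
  rw [hv] at h1 h2
  simp only [Set.mem_diff, SimpleGraph.mem_neighborSet, h1, h2, h3]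

/-- If the minimum degree of a finite connected simple graph exceeds `d ≥ 1` and its maximum
degree is less than `2d + 2`, then every `d`-stable trace is a strong trace. -/
theorem stableTrace_isStrongTrace {V : Type*} [Fintype V] [DecidableEq V]
    (G : SimpleGraph V) [DecidableRel G.Adj] (hG : G.Connected) (d : ℕ) (hd : 1 ≤ d)
    (hmin : d < G.minDegree) (hmax : G.maxDegree < 2 * d + 2) :
    ∀ (x : V) (w : G.Walk x x), IsStableTrace d w → IsStrongTrace w := by
  intro x w hw
  refine ⟨hw.1, fun v N hN hne hproper hrep => ?_⟩
  have hcard : (G.neighborSet v \ N).ncard + N.ncard = (G.neighborSet v).ncard :=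
    Set.ncard_sdiff_add_ncard_of_subset hN
  have hdeg : (G.neighborSet v).ncard = G.degree v := by
    rw [Set.ncard_eq_toFinset_card', ← SimpleGraph.card_neighborFinset_eq_degree]
    rfl
  have hle := G.degree_le_maxDegree v
  have hpos : 0 < N.ncard := (Set.ncard_pos).2 hne
  have hpos' : 0 < (G.neighborSet v \ N).ncard :=
    (Set.ncard_pos).2 (Set.sdiff_nonempty.2 fun h => hproper (hN.antisymm h))
  rcases Nat.lt_or_ge d N.ncard with h | h
  · exact hw.2 v _ Set.sdiff_subset hpos' (by omega) (hasRepetition_compl_aux w v N hrep)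
  · exact hw.2 v N hN hpos h hrep
end
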